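/- arXiv:1110.5746 — 4 statements merged into one kernel-verified Lean document; each statement's English description precedes it below -/
import Mathlib

section
/- Suppose the quantum channel N_B is more capable, i.e. for every n ≥ 1 and every finite ensemble of pure (rank-one) states on (ℂ^{d_A})^{⊗n} the Holevo quantity with respect to N_B^{⊗n} is at least the Holevo quantity with respect to N_E^{⊗n}. Then the private capacity equals the quantum capacity: sup_{n≥1} (1/n) C_p^{(1)}(N_B^{⊗n}) = sup_{n≥1} (1/n) Q^{(1)}(N_B^{⊗n}). -/
open Matrix BigOperators
open scoped ComplexOrder

noncomputable section

/-- Matrix logarithm via the spectral decomposition (junk value `0` off Hermitian matrices;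
eigenvalue `0` contributes `Real.log 0 = 0`). -/
def matLog {n : Type*} [Fintype n] [DecidableEq n] (ρ : Matrix n n ℂ) : Matrix n n ℂ :=
  if h : ρ.IsHermitian then
    (h.eigenvectorUnitary : Matrix n n ℂ) *
      Matrix.diagonal (fun i => (Real.log (h.eigenvalues i) : ℂ)) *
      (h.eigenvectorUnitary : Matrix n n ℂ)ᴴ
  else 0

/-- Von Neumann entropy `H(ρ) = -Tr[ρ log ρ]`. -/
def vnEntropy {n : Type*} [Fintype n] [DecidableEq n] (ρ : Matrix n n ℂ) : ℝ :=
  - (ρ * matLog ρ).trace.re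

/-- Quantum relative entropy `D(ρ‖σ) = Tr[ρ (log ρ - log σ)]`. -/
def relEntropy {n : Type*} [Fintype n] [DecidableEq n] (ρ σ : Matrix n n ℂ) : ℝ :=
  (ρ * (matLog ρ - matLog σ)).trace.re

/-- A state: positive semidefinite with unit trace. -/
def IsState {n : Type*} [Fintype n] (ρ : Matrix n n ℂ) : Prop :=
  ρ.PosSemidef ∧ ρ.trace = 1

/-- A pure (rank-one) state `|ψ⟩⟨ψ|` for a unit vector `ψ`. -/
def IsPureState {n : Type*} [Fintype n] (ρ : Matrix n n ℂ) : Prop :=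
  ∃ ψ : n → ℂ, (∑ i, Complex.normSq (ψ i)) = 1 ∧ ρ = Matrix.vecMulVec ψ (star ψ)

/-- Support (range) inclusion for matrices. -/
def suppLE {n : Type*} [Fintype n] [DecidableEq n] (ρ σ : Matrix n n ℂ) : Prop :=
  LinearMap.range (Matrix.toLin' ρ) ≤ LinearMap.range (Matrix.toLin' σ)

/-- Partial trace over the second tensor factor. -/
def ptraceSnd {α β : Type*} [Fintype β] (M : Matrix (α × β) (α × β) ℂ) : Matrix α α ℂ :=
  Matrix.of fun i j => ∑ k, M (i, k) (j, k)

/-- Partial trace over the first tensor factor. -/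
def ptraceFst {α β : Type*} [Fintype α] (M : Matrix (α × β) (α × β) ℂ) : Matrix β β ℂ :=
  Matrix.of fun i j => ∑ k, M (k, i) (k, j)

variable {dA dB dE : ℕ}

/-- The channel `N_B(ρ) = Tr_E[U ρ U†]`. -/
def chanB (U : Matrix (Fin dB × Fin dE) (Fin dA) ℂ) (ρ : Matrix (Fin dA) (Fin dA) ℂ) :
    Matrix (Fin dB) (Fin dB) ℂ := ptraceSnd (U * ρ * Uᴴ)

/-- The complementary channel `N_E(ρ) = Tr_B[U ρ U†]`. -/
def chanE (U : Matrix (Fin dB × Fin dE) (Fin dA) ℂ) (ρ : Matrix (Fin dA) (Fin dA) ℂ) :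
    Matrix (Fin dE) (Fin dE) ℂ := ptraceFst (U * ρ * Uᴴ)

/-- Coherent information `I_c(ρ) = H(N_B(ρ)) - H(N_E(ρ))`. -/
def cohInfo (U : Matrix (Fin dB × Fin dE) (Fin dA) ℂ) (ρ : Matrix (Fin dA) (Fin dA) ℂ) : ℝ :=
  vnEntropy (chanB U ρ) - vnEntropy (chanE U ρ)

/-- Holevo quantity of the ensemble `(p, σ)` with respect to the channel `N`. -/
def holevo {ι inn out : Type*} [Fintype ι] [Fintype out] [DecidableEq out]
    [AddCommMonoid (Matrix inn inn ℂ)]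
    (N : Matrix inn inn ℂ → Matrix out out ℂ)
    (p : ι → ℝ) (σ : ι → Matrix inn inn ℂ) : ℝ :=
  vnEntropy (N (∑ u, (p u : ℂ) • σ u)) - ∑ u, p u * vnEntropy (N (σ u))

/-- A finite ensemble: a probability distribution together with states. -/
def IsEnsemble {ι inn : Type*} [Fintype ι] [Fintype inn]
    (p : ι → ℝ) (σ : ι → Matrix inn inn ℂ) : Prop :=
  (∀ u, 0 ≤ p u) ∧ (∑ u, p u = 1) ∧ (∀ u, IsState (σ u))

/-- `Q^{(1)}`: optimized coherent information. -/
def Q1 (U : Matrix (Fin dB × Fin dE) (Fin dA) ℂ) : ℝ :=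
  sSup { r | ∃ ρ, IsState ρ ∧ r = cohInfo U ρ }

/-- `C_p^{(1)}`: optimized difference of Holevo quantities. -/
def Cp1 (U : Matrix (Fin dB × Fin dE) (Fin dA) ℂ) : ℝ :=
  sSup { r | ∃ (m : ℕ) (p : Fin m → ℝ) (σ : Fin m → Matrix (Fin dA) (Fin dA) ℂ),
    IsEnsemble p σ ∧ r = holevo (chanB U) p σ - holevo (chanE U) p σ }

/-- The `n`-fold tensor power `U^{⊗n}`, as a matrix from `(ℂ^{d_A})^{⊗n}`
to `(ℂ^{d_B})^{⊗n} ⊗ (ℂ^{d_E})^{⊗n}`. -/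
def tensorPowIso (U : Matrix (Fin dB × Fin dE) (Fin dA) ℂ) (n : ℕ) :
    Matrix ((Fin n → Fin dB) × (Fin n → Fin dE)) (Fin n → Fin dA) ℂ :=
  Matrix.of fun be a => ∏ i, U (be.1 i, be.2 i) (a i)

/-- The `n`-fold channel `N_B^{⊗n}`. -/
def chanBn (U : Matrix (Fin dB × Fin dE) (Fin dA) ℂ) (n : ℕ)
    (ρ : Matrix (Fin n → Fin dA) (Fin n → Fin dA) ℂ) :
    Matrix (Fin n → Fin dB) (Fin n → Fin dB) ℂ :=
  ptraceSnd (tensorPowIso U n * ρ * (tensorPowIso U n)ᴴ)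

/-- The `n`-fold complementary channel `N_E^{⊗n}`. -/
def chanEn (U : Matrix (Fin dB × Fin dE) (Fin dA) ℂ) (n : ℕ)
    (ρ : Matrix (Fin n → Fin dA) (Fin n → Fin dA) ℂ) :
    Matrix (Fin n → Fin dE) (Fin n → Fin dE) ℂ :=
  ptraceFst (tensorPowIso U n * ρ * (tensorPowIso U n)ᴴ)

/-- Coherent information of the `n`-fold channel. -/
def cohInfoN (U : Matrix (Fin dB × Fin dE) (Fin dA) ℂ) (n : ℕ)
    (ρ : Matrix (Fin n → Fin dA) (Fin n → Fin dA) ℂ) : ℝ :=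
  vnEntropy (chanBn U n ρ) - vnEntropy (chanEn U n ρ)

/-- `Q^{(1)}(N_B^{⊗n})`. -/
def Q1n (U : Matrix (Fin dB × Fin dE) (Fin dA) ℂ) (n : ℕ) : ℝ :=
  sSup { r | ∃ ρ, IsState ρ ∧ r = cohInfoN U n ρ }

/-- `C_p^{(1)}(N_B^{⊗n})`. -/
def Cp1n (U : Matrix (Fin dB × Fin dE) (Fin dA) ℂ) (n : ℕ) : ℝ :=
  sSup { r | ∃ (m : ℕ) (p : Fin m → ℝ)
    (σ : Fin m → Matrix (Fin n → Fin dA) (Fin n → Fin dA) ℂ),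
    IsEnsemble p σ ∧ r = holevo (chanBn U n) p σ - holevo (chanEn U n) p σ }

/-- Quantum capacity `Q(N_B) = sup_{n ≥ 1} Q^{(1)}(N_B^{⊗n}) / n`. -/
def Qcap (U : Matrix (Fin dB × Fin dE) (Fin dA) ℂ) : ℝ :=
  sSup { r | ∃ n : ℕ, 1 ≤ n ∧ r = Q1n U n / n }

/-- Private capacity `C_p(N_B) = sup_{n ≥ 1} C_p^{(1)}(N_B^{⊗n}) / n`. -/
def Cpcap (U : Matrix (Fin dB × Fin dE) (Fin dA) ℂ) : ℝ :=
  sSup { r | ∃ n : ℕ, 1 ≤ n ∧ r = Cp1n U n / n }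

theorem aux_vnEntropy_eq {n : Type*} [Fintype n] [DecidableEq n] (ρ : Matrix n n ℂ)
    (h : ρ.IsHermitian) :
    vnEntropy ρ = - (ρ.charpoly.roots.map (fun z : ℂ => z.re * Real.log z.re)).sum := by
  have hV : (h.eigenvectorUnitary : Matrix n n ℂ)ᴴ * (h.eigenvectorUnitary : Matrix n n ℂ) = 1 :=
    Unitary.coe_star_mul_self h.eigenvectorUnitary
  have hρ : ρ = (h.eigenvectorUnitary : Matrix n n ℂ) *
      Matrix.diagonal (fun i => (h.eigenvalues i : ℂ)) *
      (h.eigenvectorUnitary : Matrix n n ℂ)ᴴ := by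
    conv_lhs => rw [h.spectral_theorem, Unitary.conjStarAlgAut_apply]
    rfl
  have key : (ρ * matLog ρ).trace
      = ∑ i, ((h.eigenvalues i * Real.log (h.eigenvalues i) : ℝ) : ℂ) := by
    rw [matLog, dif_pos h]
    set V := (h.eigenvectorUnitary : Matrix n n ℂ)
    set D := Matrix.diagonal (fun i => (h.eigenvalues i : ℂ))
    set L := Matrix.diagonal (fun i => (Real.log (h.eigenvalues i) : ℂ))
    have : ρ * (V * L * Vᴴ) = V * (D * L) * Vᴴ := by
      calc ρ * (V * L * Vᴴ) = V * D * Vᴴ * (V * L * Vᴴ) := by rw [← hρ]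
        _ = V * D * (Vᴴ * V) * L * Vᴴ := by simp only [Matrix.mul_assoc]
        _ = V * (D * L) * Vᴴ := by rw [hV]; simp only [Matrix.mul_assoc, Matrix.one_mul]
    rw [this, Matrix.trace_mul_comm, ← Matrix.mul_assoc, hV, Matrix.one_mul,
      Matrix.diagonal_mul_diagonal, Matrix.trace_diagonal]
    simp
  rw [vnEntropy, key, h.roots_charpoly_eq_eigenvalues, Multiset.map_map, ← Complex.ofReal_sum,
    Complex.ofReal_re]
  rfl

theorem aux_vnEntropy_comm {α β : Type*} [Fintype α] [DecidableEq α] [Fintype β] [DecidableEq β]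
    (M : Matrix α β ℂ) : vnEntropy (M * Mᴴ) = vnEntropy (Mᴴ * M)ᵀ := by
  have h1 : (M * Mᴴ).IsHermitian := Matrix.isHermitian_mul_conjTranspose_self M
  have h2 : (Mᴴ * M)ᵀ.IsHermitian := (Matrix.isHermitian_conjTranspose_mul_self M).transpose
  rw [aux_vnEntropy_eq _ h1, aux_vnEntropy_eq _ h2, Matrix.charpoly_transpose]
  have hc := congrArg Polynomial.roots (Matrix.charpoly_mul_comm' M Mᴴ)
  have e1 : (Polynomial.X ^ Fintype.card β * (M * Mᴴ).charpoly : Polynomial ℂ) ≠ 0 :=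
    mul_ne_zero (pow_ne_zero _ Polynomial.X_ne_zero) (Matrix.charpoly_monic _).ne_zero
  have e2 : (Polynomial.X ^ Fintype.card α * (Mᴴ * M).charpoly : Polynomial ℂ) ≠ 0 :=
    mul_ne_zero (pow_ne_zero _ Polynomial.X_ne_zero) (Matrix.charpoly_monic _).ne_zero
  rw [Polynomial.roots_mul e1, Polynomial.roots_mul e2, Polynomial.roots_pow, Polynomial.roots_pow,
    Polynomial.roots_X] at hc
  have := congrArg (fun s : Multiset ℂ =>
    (s.map (fun z : ℂ => z.re * Real.log z.re)).sum) hc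
  simp only [Multiset.map_add, Multiset.sum_add, Multiset.map_nsmul, Multiset.sum_nsmul,
    Multiset.map_singleton, Multiset.sum_singleton] at this
  simp at this
  rw [this]

theorem aux_schmidt {α β : Type*} [Fintype α] [DecidableEq α] [Fintype β] [DecidableEq β]
    (φ : α × β → ℂ) : vnEntropy (ptraceSnd (vecMulVec φ (star φ)))
      = vnEntropy (ptraceFst (vecMulVec φ (star φ))) := by
  have := aux_vnEntropy_comm (Matrix.of fun i k => φ (i, k))
  convert this using 2
  · ext i j
    simp [ptraceSnd, vecMulVec_apply, Matrix.mul_apply]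
  · ext i j
    simp [ptraceFst, vecMulVec_apply, Matrix.mul_apply, mul_comm]

theorem aux_pure {dA dB dE : ℕ} (U : Matrix (Fin dB × Fin dE) (Fin dA) ℂ) (n : ℕ)
    (ρ : Matrix (Fin n → Fin dA) (Fin n → Fin dA) ℂ) (h : IsPureState ρ) :
    vnEntropy (chanBn U n ρ) = vnEntropy (chanEn U n ρ) := by
  obtain ⟨ψ, -, rfl⟩ := h
  have : tensorPowIso U n * vecMulVec ψ (star ψ) * (tensorPowIso U n)ᴴ
      = vecMulVec (tensorPowIso U n *ᵥ ψ) (star (tensorPowIso U n *ᵥ ψ)) := by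
    rw [Matrix.mul_vecMulVec, Matrix.vecMulVec_mul, Matrix.star_mulVec]
  rw [chanBn, chanEn, this]
  exact aux_schmidt _

theorem aux_decomp {n : Type*} [Fintype n] [DecidableEq n] (ρ : Matrix n n ℂ) (h : IsState ρ) :
    ∃ (m : ℕ) (p : Fin m → ℝ) (σ : Fin m → Matrix n n ℂ), IsEnsemble p σ ∧
      (∀ u, IsPureState (σ u)) ∧ ∑ u, (p u : ℂ) • σ u = ρ := by
  obtain ⟨hp, ht⟩ := h
  have hH := hp.isHermitian
  set V := (hH.eigenvectorUnitary : Matrix n n ℂ) with hVdef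
  have hV : Vᴴ * V = 1 :=
    Unitary.coe_star_mul_self hH.eigenvectorUnitary
  have hρ : ρ = V * Matrix.diagonal (fun i => (hH.eigenvalues i : ℂ)) * Vᴴ := by
    conv_lhs => rw [hH.spectral_theorem, Unitary.conjStarAlgAut_apply]
    rfl
  let e := (Fintype.equivFin n).symm
  let s : n → Matrix n n ℂ := fun k => vecMulVec (fun i => V i k) (star (fun i => V i k))
  have hn : ∀ k, ∑ i, Complex.normSq (V i k) = 1 := by
    intro k
    have := congrFun (congrFun hV k) k
    rw [Matrix.mul_apply, Matrix.one_apply_eq] at this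
    have h2 : ((∑ i, Complex.normSq (V i k) : ℝ) : ℂ) = 1 := by
      rw [← this, Complex.ofReal_sum]
      refine Finset.sum_congr rfl fun i _ => ?_
      rw [Complex.normSq_eq_conj_mul_self]; rfl
    exact_mod_cast h2
  refine ⟨Fintype.card n, fun u => hH.eigenvalues (e u), fun u => s (e u), ⟨?_, ?_, ?_⟩, ?_, ?_⟩
  · intro u; exact hp.eigenvalues_nonneg _
  · rw [e.sum_comp hH.eigenvalues]
    have := hH.trace_eq_sum_eigenvalues
    rw [ht] at this
    have h2 : ((∑ i, hH.eigenvalues i : ℝ) : ℂ) = 1 := by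
      rw [this, Complex.ofReal_sum]; rfl
    exact_mod_cast h2
  · intro u
    refine ⟨Matrix.posSemidef_vecMulVec_self_star _, ?_⟩
    have := hn (e u)
    rw [Matrix.trace]
    simp only [s, Matrix.diag_apply, vecMulVec_apply, Pi.star_apply]
    have h2 : ((∑ i, Complex.normSq (V i (e u)) : ℝ) : ℂ) = 1 := by rw [this]; simp
    rw [← h2, Complex.ofReal_sum]
    refine Finset.sum_congr rfl fun i _ => ?_
    rw [Complex.normSq_eq_conj_mul_self, mul_comm]; rfl
  · intro u; exact ⟨_, hn (e u), rfl⟩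
  · rw [e.sum_comp (fun k => (hH.eigenvalues k : ℂ) • s k)]
    conv_rhs => rw [hρ]
    ext i j
    rw [Matrix.sum_apply, Matrix.mul_apply]
    refine Finset.sum_congr rfl fun k _ => ?_
    simp [s, vecMulVec_apply, Matrix.mul_diagonal]
    ring

theorem aux_pure_diff {dA dB dE : ℕ} (U : Matrix (Fin dB × Fin dE) (Fin dA) ℂ) (n m : ℕ)
    (p : Fin m → ℝ) (σ : Fin m → Matrix (Fin n → Fin dA) (Fin n → Fin dA) ℂ)
    (h : ∀ u, IsPureState (σ u)) :
    holevo (chanBn U n) p σ - holevo (chanEn U n) p σ = cohInfoN U n (∑ u, (p u : ℂ) • σ u) := by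
  simp only [holevo, cohInfoN, aux_pure U n _ (h _)]
  ring

theorem aux_avg {n : Type*} [Fintype n] [DecidableEq n] {m : ℕ} (p : Fin m → ℝ)
    (σ : Fin m → Matrix n n ℂ) (h : IsEnsemble p σ) : IsState (∑ u, (p u : ℂ) • σ u) := by
  obtain ⟨h1, h2, h3⟩ := h
  refine ⟨Matrix.posSemidef_sum _ fun u _ => (h3 u).1.smul (by exact_mod_cast h1 u), ?_⟩
  rw [Matrix.trace_sum]
  simp only [Matrix.trace_smul, (h3 _).2, smul_eq_mul, mul_one]
  exact_mod_cast h2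

theorem aux_sSup_eq {S T : Set ℝ} (h1 : S ⊆ T) (h2 : ∀ t ∈ T, ∃ s ∈ S, t ≤ s) :
    sSup T = sSup S := by
  rcases S.eq_empty_or_nonempty with rfl | hS
  · have : T = ∅ := by
      ext t; constructor
      · intro ht; obtain ⟨s, hs, _⟩ := h2 t ht; exact hs
      · intro ht; exact ht.elim
    rw [this]
  by_cases hb : BddAbove S
  · have hT : BddAbove T := by
      obtain ⟨b, hb⟩ := hb
      exact ⟨b, fun t ht => by obtain ⟨s, hs, hts⟩ := h2 t ht; exact hts.trans (hb hs)⟩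
    apply le_antisymm
    · refine csSup_le (hS.mono h1) fun t ht => ?_
      obtain ⟨s, hs, hts⟩ := h2 t ht
      exact hts.trans (le_csSup hb hs)
    · exact csSup_le_csSup hT hS h1
  · rw [Real.sSup_of_not_bddAbove hb, Real.sSup_of_not_bddAbove fun hT => hb (hT.mono h1)]

/-- If the channel `N_B` is more capable (for every `n ≥ 1`, every finite
ensemble of pure states on `(ℂ^{d_A})^{⊗n}` has Holevo quantity w.r.t. `N_B^{⊗n}` at least
that w.r.t. `N_E^{⊗n}`), then the private capacity equals the quantum capacity. -/
theorem more_capable_implies_private_eq_quantum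
    {dA dB dE : ℕ} (hdA : 1 ≤ dA) (hdB : 1 ≤ dB) (hdE : 1 ≤ dE)
    (U : Matrix (Fin dB × Fin dE) (Fin dA) ℂ) (hU : Uᴴ * U = 1)
    (hmc : ∀ n : ℕ, 1 ≤ n → ∀ (m : ℕ) (p : Fin m → ℝ)
      (σ : Fin m → Matrix (Fin n → Fin dA) (Fin n → Fin dA) ℂ),
      IsEnsemble p σ → (∀ u, IsPureState (σ u)) →
      holevo (chanEn U n) p σ ≤ holevo (chanBn U n) p σ) :
    Cpcap U = Qcap U := by
  have key : ∀ n : ℕ, 1 ≤ n → Cp1n U n = Q1n U n := by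
    intro n hn
    have hnn : ∀ ρ, IsState ρ → 0 ≤ cohInfoN U n ρ := by
      intro ρ hρ
      obtain ⟨m, p, σ, he, hpure, rfl⟩ := aux_decomp ρ hρ
      rw [← aux_pure_diff U n m p σ hpure]
      exact sub_nonneg.2 (hmc n hn m p σ he hpure)
    refine aux_sSup_eq ?_ ?_
    · rintro r ⟨ρ, hρ, rfl⟩
      obtain ⟨m, p, σ, he, hpure, rfl⟩ := aux_decomp ρ hρ
      exact ⟨m, p, σ, he, (aux_pure_diff U n m p σ hpure).symm⟩
    · rintro r ⟨m, p, σ, he, rfl⟩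
      refine ⟨_, ⟨_, aux_avg p σ he, rfl⟩, ?_⟩
      have : 0 ≤ ∑ u, p u * cohInfoN U n (σ u) :=
        Finset.sum_nonneg fun u _ => mul_nonneg (he.1 u) (hnn _ (he.2.2 u))
      simp only [cohInfoN, mul_sub, Finset.sum_sub_distrib] at this
      simp only [holevo, cohInfoN]
      linarith
  unfold Cpcap Qcap
  congr 1
  ext r
  constructor
  · rintro ⟨n, hn, rfl⟩; exact ⟨n, hn, by rw [key n hn]⟩
  · rintro ⟨n, hn, rfl⟩; exact ⟨n, hn, by rw [key n hn]⟩

end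
end

section
/- Suppose the quantum channel N_B is less noisy, i.e. for every n ≥ 1 and every finite ensemble of states on (ℂ^{d_A})^{⊗n} the Holevo quantity with respect to N_B^{⊗n} is at least the Holevo quantity with respect to N_E^{⊗n}. Then the private capacity and quantum capacity are both single-letter characterized: sup_{n≥1} (1/n) C_p^{(1)}(N_B^{⊗n}) = sup_{n≥1} (1/n) Q^{(1)}(N_B^{⊗n}) = Q^{(1)}(N_B). -/
open Matrix BigOperators
open scoped ComplexOrder

noncomputable section

variable {dA dB dE : ℕ}

theorem ent_eq {n : Type*} [Fintype n] [DecidableEq n] {ω : Matrix n n ℂ} (h : ω.IsHermitian) :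
    vnEntropy ω = ∑ i, Real.negMulLog (h.eigenvalues i) := by
  have hs := h.spectral_theorem
  rw [Unitary.conjStarAlgAut_apply] at hs
  set V : Matrix n n ℂ := (h.eigenvectorUnitary : Matrix n n ℂ) with hV
  have hVV : Vᴴ * V = 1 := by
    have := Unitary.coe_star_mul_self h.eigenvectorUnitary
    simpa [hV, Matrix.star_eq_conjTranspose] using this
  have e : ω * matLog ω = V * (Matrix.diagonal (fun i => (h.eigenvalues i : ℂ)) *
      Matrix.diagonal (fun i => (Real.log (h.eigenvalues i) : ℂ))) * Vᴴ := by
    unfold matLog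
    rw [dif_pos h, ← hV]
    have hs' : ω = V * Matrix.diagonal (fun i => (h.eigenvalues i : ℂ)) * Vᴴ := by
      simpa [Function.comp_def, Matrix.star_eq_conjTranspose] using hs
    calc ω * (V * Matrix.diagonal (fun i => (Real.log (h.eigenvalues i) : ℂ)) * Vᴴ)
        = (V * Matrix.diagonal (fun i => (h.eigenvalues i : ℂ)) * Vᴴ) *
          (V * Matrix.diagonal (fun i => (Real.log (h.eigenvalues i) : ℂ)) * Vᴴ) := by
          congr 1
      _ = V * Matrix.diagonal (fun i => (h.eigenvalues i : ℂ)) * (Vᴴ * V) *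
          Matrix.diagonal (fun i => (Real.log (h.eigenvalues i) : ℂ)) * Vᴴ := by
          simp only [Matrix.mul_assoc]
      _ = _ := by rw [hVV]; simp only [Matrix.mul_assoc, Matrix.one_mul]
  unfold vnEntropy
  rw [e, Matrix.trace_mul_comm, ← Matrix.mul_assoc, hVV, Matrix.one_mul,
    Matrix.diagonal_mul_diagonal, Matrix.trace_diagonal]
  simp only [← Complex.ofReal_mul, ← Complex.ofReal_sum, Complex.ofReal_re, Real.negMulLog]
  rw [← Finset.sum_neg_distrib]
  exact Finset.sum_congr rfl fun i _ => by ring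

theorem spec_form {n : Type*} [Fintype n] [DecidableEq n] {ω : Matrix n n ℂ}
    (h : ω.IsHermitian) : ∃ V : Matrix n n ℂ, Vᴴ * V = 1 ∧
      ω = V * Matrix.diagonal (fun i => (h.eigenvalues i : ℂ)) * Vᴴ := by
  have hs := h.spectral_theorem
  rw [Unitary.conjStarAlgAut_apply] at hs
  refine ⟨(h.eigenvectorUnitary : Matrix n n ℂ), ?_, ?_⟩
  · have := Unitary.coe_star_mul_self h.eigenvectorUnitary
    simpa [Matrix.star_eq_conjTranspose] using this
  · simpa [Function.comp_def, Matrix.star_eq_conjTranspose] using hs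

theorem ent_charpoly {n : Type*} [Fintype n] [DecidableEq n] {ω : Matrix n n ℂ}
    (h : ω.IsHermitian) :
    vnEntropy ω = (ω.charpoly.roots.map (fun z => Real.negMulLog z.re)).sum := by
  rw [ent_eq h, h.roots_charpoly_eq_eigenvalues]
  rw [Multiset.map_map]
  rfl

theorem ent_congr {m n : Type*} [Fintype n] [DecidableEq n] [Fintype m] [DecidableEq m]
    {ω : Matrix n n ℂ} {τ : Matrix m m ℂ} (h : ω.IsHermitian) (h' : τ.IsHermitian) (k l : ℕ)
    (e : Polynomial.X ^ k * ω.charpoly = Polynomial.X ^ l * τ.charpoly) :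
    vnEntropy ω = vnEntropy τ := by
  rw [ent_charpoly h, ent_charpoly h']
  have e2 := congrArg Polynomial.roots e
  have n1 : (Polynomial.X ^ k * ω.charpoly) ≠ 0 :=
    (mul_ne_zero (pow_ne_zero _ Polynomial.X_ne_zero) ω.charpoly_monic.ne_zero)
  have n2 : (Polynomial.X ^ l * τ.charpoly) ≠ 0 :=
    (mul_ne_zero (pow_ne_zero _ Polynomial.X_ne_zero) τ.charpoly_monic.ne_zero)
  rw [Polynomial.roots_mul n1, Polynomial.roots_mul n2, Polynomial.roots_X_pow,
    Polynomial.roots_X_pow] at e2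
  have e3 := congrArg (fun s => (Multiset.map (fun z : ℂ => Real.negMulLog z.re) s).sum) e2
  simpa [Multiset.map_nsmul, Multiset.sum_nsmul] using e3

theorem ent_pure {m n : Type*} [Fintype n] [DecidableEq n] [Fintype m] [DecidableEq m]
    (M : Matrix m n ℂ) : vnEntropy (M * Mᴴ) = vnEntropy ((Mᴴ * M)ᵀ) := by
  refine ent_congr (Matrix.isHermitian_mul_conjTranspose_self M)
    (Matrix.isHermitian_conjTranspose_mul_self M).transpose (Fintype.card n) (Fintype.card m) ?_
  rw [Matrix.charpoly_transpose]
  exact Matrix.charpoly_mul_comm' _ _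

theorem ent_nonneg {n : Type*} [Fintype n] [DecidableEq n] {ω : Matrix n n ℂ}
    (h : IsState ω) : 0 ≤ vnEntropy ω := by
  rw [ent_eq h.1.1]
  have ht := h.1.1.trace_eq_sum_eigenvalues
  have ht' : ∑ i, h.1.1.eigenvalues i = 1 := by
    have := congrArg Complex.re (ht.symm.trans h.2)
    simpa [Complex.re_sum] using this
  refine Finset.sum_nonneg fun i _ => Real.negMulLog_nonneg (h.1.eigenvalues_nonneg i) ?_
  rw [← ht']
  exact Finset.single_le_sum (fun j _ => h.1.eigenvalues_nonneg j) (Finset.mem_univ i)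

theorem ent_le {n : Type*} [Fintype n] [DecidableEq n] {ω : Matrix n n ℂ}
    (h : IsState ω) : vnEntropy ω ≤ Fintype.card n := by
  rw [ent_eq h.1.1]
  have : ∀ i ∈ Finset.univ, Real.negMulLog (h.1.1.eigenvalues i) ≤ 1 := by
    intro i _
    have h0 := h.1.eigenvalues_nonneg i
    rcases h0.eq_or_lt with h1 | h1
    · rw [← h1]; simp
    · have := Real.one_sub_inv_le_log_of_pos h1
      have h3 := mul_le_mul_of_nonneg_left this h0
      rw [mul_sub, mul_inv_cancel₀ h1.ne'] at h3
      unfold Real.negMulLog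
      linarith
  calc _ ≤ ∑ i : n, (1:ℝ) := Finset.sum_le_sum this
    _ = _ := by simp

theorem exists_P {n : Type*} [Fintype n] [DecidableEq n] {ω W : Matrix n n ℂ}
    (h : ω.PosSemidef) (hW : Wᴴ * W = 1) :
    ∃ (a : n → ℝ) (P : n → n → ℝ), (∀ i, 0 ≤ a i) ∧ (∀ i j, 0 ≤ P i j) ∧
      (∀ i, ∑ j, P i j = 1) ∧ (∀ j, ∑ i, P i j = 1) ∧
      vnEntropy ω = ∑ i, Real.negMulLog (a i) ∧
      (∀ j, ((Wᴴ * ω * W) j j).re = ∑ i, P i j * a i) ∧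
      (∀ j, (((Wᴴ * ω * W) * (Wᴴ * ω * W)) j j).re = ∑ i, P i j * a i ^ 2) := by
  obtain ⟨V, hV, hω⟩ := spec_form h.1
  have hV' : V * Vᴴ = 1 := mul_eq_one_comm.mp hV
  have hW' : W * Wᴴ = 1 := mul_eq_one_comm.mp hW
  set Z := Vᴴ * W with hZ
  have hZ1 : Zᴴ * Z = 1 := by
    rw [hZ, Matrix.conjTranspose_mul, Matrix.conjTranspose_conjTranspose, Matrix.mul_assoc,
      ← Matrix.mul_assoc V, hV', Matrix.one_mul, hW]
  have hZ2 : Z * Zᴴ = 1 := mul_eq_one_comm.mp hZ1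
  have key : ∀ d : n → ℝ, ∀ j, ((Zᴴ * Matrix.diagonal (fun i => (d i : ℂ)) * Z) j j).re
      = ∑ i, Complex.normSq (Z i j) * d i := by
    intro d j
    rw [Matrix.mul_apply, Complex.re_sum]
    refine Finset.sum_congr rfl fun i _ => ?_
    rw [Matrix.mul_diagonal, Matrix.conjTranspose_apply, mul_right_comm]
    have : star (Z i j) * Z i j = (Complex.normSq (Z i j) : ℂ) := by
      rw [Complex.normSq_eq_conj_mul_self]; rfl
    rw [this, ← Complex.ofReal_mul, Complex.ofReal_re]
  have hR : Wᴴ * ω * W = Zᴴ * Matrix.diagonal (fun i => (h.1.eigenvalues i : ℂ)) * Z := by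
    conv_lhs => rw [hω]
    rw [hZ, Matrix.conjTranspose_mul, Matrix.conjTranspose_conjTranspose]
    simp only [Matrix.mul_assoc]
  refine ⟨h.1.eigenvalues, fun i j => Complex.normSq (Z i j), h.eigenvalues_nonneg,
    fun i j => Complex.normSq_nonneg _, ?_, ?_, ent_eq h.1, ?_, ?_⟩
  · intro i
    have := congrFun (congrFun hZ2 i) i
    rw [Matrix.mul_apply, Matrix.one_apply_eq] at this
    have h2 : ∀ j, Z i j * Zᴴ j i = (Complex.normSq (Z i j) : ℂ) := by
      intro j
      rw [Matrix.conjTranspose_apply, mul_comm, Complex.normSq_eq_conj_mul_self]; rfl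
    simp only [h2] at this
    exact_mod_cast this
  · intro j
    have := key (fun _ => 1) j
    simp only [mul_one, Complex.ofReal_one, Matrix.diagonal_one, hZ1, Matrix.one_apply_eq,
      Complex.one_re] at this
    exact this.symm
  · intro j
    rw [hR, key]
  · intro j
    rw [hR, ← key (fun i => h.1.eigenvalues i ^ 2)]
    refine congrArg (fun X : Matrix n n ℂ => (X j j).re) ?_
    calc (Zᴴ * Matrix.diagonal (fun i => (h.1.eigenvalues i : ℂ)) * Z) *
          (Zᴴ * Matrix.diagonal (fun i => (h.1.eigenvalues i : ℂ)) * Z) = Zᴴ * Matrix.diagonal (fun i => (h.1.eigenvalues i : ℂ)) * (Z * Zᴴ) *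
          Matrix.diagonal (fun i => (h.1.eigenvalues i : ℂ)) * Z := by
          simp only [Matrix.mul_assoc]
      _ = Zᴴ * (Matrix.diagonal (fun i => (h.1.eigenvalues i : ℂ)) *
          Matrix.diagonal (fun i => (h.1.eigenvalues i : ℂ))) * Z := by
          rw [hZ2, Matrix.mul_one]; simp only [Matrix.mul_assoc]
      _ = _ := by
          rw [Matrix.diagonal_mul_diagonal]
          simp [pow_two]

theorem klein {n : Type*} [Fintype n] [DecidableEq n] {ω W : Matrix n n ℂ}
    (h : ω.PosSemidef) (hW : Wᴴ * W = 1) (b : n → ℝ) (hb : ∀ j, 0 ≤ b j)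
    (h0 : ∀ j, b j = 0 → ((Wᴴ * ω * W) j j).re = 0)
    (hs : ∑ j, b j = ∑ j, ((Wᴴ * ω * W) j j).re) :
    vnEntropy ω ≤ - ∑ j, ((Wᴴ * ω * W) j j).re * Real.log (b j) := by
  obtain ⟨a, P, ha, hP, hr, hc, hH, h1, -⟩ := exists_P h hW
  simp only [h1] at h0 hs ⊢
  have z : ∀ i j, b j = 0 → P i j * a i = 0 := fun i j hj =>
    (Finset.sum_eq_zero_iff_of_nonneg (fun i _ => mul_nonneg (hP i j) (ha i))).mp (h0 j hj) i
      (Finset.mem_univ i)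
  have t : ∀ i j, P i j * Real.negMulLog (a i) + P i j * a i * Real.log (b j)
      ≤ P i j * b j - P i j * a i := by
    intro i j
    by_cases hj : b j = 0
    · have := z i j hj
      rw [this, hj, Real.negMulLog]
      have : P i j * (-a i * Real.log (a i)) = - (P i j * a i) * Real.log (a i) := by ring
      rw [this, z i j hj]; simp
    · have hbj : 0 < b j := lt_of_le_of_ne (hb j) (Ne.symm hj)
      rcases (ha i).eq_or_lt with h2 | h2
      · rw [← h2]; simp; exact mul_nonneg (hP i j) (hb j)
      · have := Real.log_le_sub_one_of_pos (div_pos hbj h2)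
        rw [Real.log_div hbj.ne' h2.ne'] at this
        have h3 := mul_le_mul_of_nonneg_left this (mul_nonneg (hP i j) (ha i))
        have h4 : P i j * a i * (b j / a i - 1) = P i j * b j - P i j * a i := by
          field_simp
        rw [h4] at h3
        unfold Real.negMulLog
        linarith
  have s := Finset.sum_le_sum fun i (_ : i ∈ Finset.univ) =>
    Finset.sum_le_sum fun j (_ : j ∈ Finset.univ) => t i j
  simp only [Finset.sum_add_distrib, Finset.sum_sub_distrib, ← Finset.sum_mul, hr, one_mul] at s
  have s1 : ∑ i, ∑ j, P i j * a i * Real.log (b j) = ∑ j, (∑ i, P i j * a i) * Real.log (b j) := by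
    rw [Finset.sum_comm]; simp only [Finset.sum_mul]
  have s2 : ∑ i, ∑ j, P i j * b j = ∑ j, b j := by
    rw [Finset.sum_comm]; simp only [← Finset.sum_mul, hc, one_mul]
  have s3 : ∑ j, ∑ i, P i j * a i = ∑ i, a i := by
    rw [Finset.sum_comm]; simp only [← Finset.sum_mul, hr, one_mul]
  rw [s1, s2] at s
  rw [s3] at hs
  rw [hH]
  linarith

theorem chi2 {n : Type*} [Fintype n] [DecidableEq n] {ω W : Matrix n n ℂ}
    (h : ω.PosSemidef) (hW : Wᴴ * W = 1) (b : n → ℝ) (hb : ∀ j, 0 ≤ b j)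
    (h0 : ∀ j, b j = 0 → ((Wᴴ * ω * W) j j).re = 0) :
    - ∑ j, ((Wᴴ * ω * W) j j).re * Real.log (b j)
      - (∑ j, (((Wᴴ * ω * W) * (Wᴴ * ω * W)) j j).re / b j - ∑ j, ((Wᴴ * ω * W) j j).re)
      ≤ vnEntropy ω := by
  obtain ⟨a, P, ha, hP, hr, hc, hH, h1, hq⟩ := exists_P h hW
  simp only [h1, hq] at h0 ⊢
  have z : ∀ i j, b j = 0 → P i j * a i = 0 := fun i j hj =>
    (Finset.sum_eq_zero_iff_of_nonneg (fun i _ => mul_nonneg (hP i j) (ha i))).mp (h0 j hj) i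
      (Finset.mem_univ i)
  have t : ∀ i j, - (P i j * a i * Real.log (b j)) - (P i j * a i ^ 2 / b j - P i j * a i)
      ≤ P i j * Real.negMulLog (a i) := by
    intro i j
    by_cases hj : b j = 0
    · have := z i j hj
      rw [this, hj, Real.negMulLog]
      have : P i j * (-a i * Real.log (a i)) = - (P i j * a i) * Real.log (a i) := by ring
      rw [this, z i j hj]; simp
    · have hbj : 0 < b j := lt_of_le_of_ne (hb j) (Ne.symm hj)
      rcases (ha i).eq_or_lt with h2 | h2
      · rw [← h2]; simp
      · have := Real.log_le_sub_one_of_pos (div_pos h2 hbj)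
        rw [Real.log_div h2.ne' hbj.ne'] at this
        have h3 := mul_le_mul_of_nonneg_left this (mul_nonneg (hP i j) (ha i))
        have h4 : P i j * a i * (a i / b j - 1) = P i j * a i ^ 2 / b j - P i j * a i := by
          field_simp
        rw [h4] at h3
        unfold Real.negMulLog
        linarith
  have s := Finset.sum_le_sum fun i (_ : i ∈ Finset.univ) =>
    Finset.sum_le_sum fun j (_ : j ∈ Finset.univ) => t i j
  simp only [Finset.sum_neg_distrib, Finset.sum_sub_distrib, ← Finset.sum_mul, hr, one_mul] at s
  have s1 : ∑ i, ∑ j, P i j * a i * Real.log (b j) = ∑ j, (∑ i, P i j * a i) * Real.log (b j) := by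
    rw [Finset.sum_comm]; simp only [Finset.sum_mul]
  have s2 : ∑ i, ∑ j, P i j * a i ^ 2 / b j = ∑ j, (∑ i, P i j * a i ^ 2) / b j := by
    rw [Finset.sum_comm]; simp only [Finset.sum_div]
  have s3 : ∑ j, ∑ i, P i j * a i = ∑ i, a i := by
    rw [Finset.sum_comm]; simp only [← Finset.sum_mul, hr, one_mul]
  rw [s1, s2] at s
  rw [hH, s3]
  linarith

/-- Perturbation bounds for the entropy around a diagonalized state. -/
theorem ent_perturb {n : Type*} [Fintype n] [DecidableEq n] {σ ρ W : Matrix n n ℂ}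
    (b : n → ℝ) (hb : ∀ j, 0 ≤ b j) (hW : Wᴴ * W = 1)
    (hσ : σ = W * Matrix.diagonal (fun j => (b j : ℂ)) * Wᴴ) (hσ1 : σ.trace = 1)
    (hρ : IsState ρ) (h0 : ∀ j, b j = 0 → ((Wᴴ * ρ * W) j j).re = 0) :
    ∃ C : ℝ, ∀ ε : ℝ, 0 ≤ ε → ε ≤ 1 →
      vnEntropy (((1 - ε : ℝ) : ℂ) • σ + (ε : ℂ) • ρ) ≤
        (1 - ε) * (- ∑ j, b j * Real.log (b j))
          + ε * (- ∑ j, ((Wᴴ * ρ * W) j j).re * Real.log (b j)) ∧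
      (1 - ε) * (- ∑ j, b j * Real.log (b j))
          + ε * (- ∑ j, ((Wᴴ * ρ * W) j j).re * Real.log (b j)) - ε ^ 2 * C ≤
        vnEntropy (((1 - ε : ℝ) : ℂ) • σ + (ε : ℂ) • ρ) := by
  have hW' : W * Wᴴ = 1 := mul_eq_one_comm.mp hW
  set R := Wᴴ * ρ * W with hR
  have hWσ : Wᴴ * σ * W = Matrix.diagonal (fun j => (b j : ℂ)) := by
    rw [hσ]
    calc _ = (Wᴴ * W) * Matrix.diagonal (fun j => (b j : ℂ)) * (Wᴴ * W) := by
          simp only [Matrix.mul_assoc]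
      _ = _ := by rw [hW]; simp
  have htr : ∀ X : Matrix n n ℂ, (Wᴴ * X * W).trace = X.trace := by
    intro X
    rw [Matrix.trace_mul_comm, ← Matrix.mul_assoc, hW', Matrix.one_mul]
  have hbs : ∑ j, b j = 1 := by
    have := htr σ
    rw [hWσ, Matrix.trace_diagonal, hσ1] at this
    exact_mod_cast this
  have hRs : ∑ j, (R j j).re = 1 := by
    have := htr ρ
    rw [← hR, hρ.2] at this
    have := congrArg Complex.re this
    simpa [Matrix.trace, Complex.re_sum] using this
  refine ⟨∑ j, ((R * R) j j).re / b j - 1, fun ε he he1 => ?_⟩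
  set ω := ((1 - ε : ℝ) : ℂ) • σ + (ε : ℂ) • ρ with hω
  have hσp : σ.PosSemidef := by
    rw [hσ]
    refine Matrix.PosSemidef.mul_mul_conjTranspose_same ?_ W
    refine Matrix.PosSemidef.diagonal fun j => ?_
    simpa using hb j
  have hωp : ω.PosSemidef := by
    refine (hσp.smul ?_).add (hρ.1.smul ?_)
    · exact_mod_cast sub_nonneg.mpr he1
    · simpa using he
  have hWω : Wᴴ * ω * W = ((1 - ε : ℝ) : ℂ) • Matrix.diagonal (fun j => (b j : ℂ))
      + (ε : ℂ) • R := by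
    rw [hω, Matrix.mul_add, Matrix.add_mul, Matrix.mul_smul, Matrix.mul_smul, Matrix.smul_mul,
      Matrix.smul_mul, hWσ]
  have hd : ∀ j, ((Wᴴ * ω * W) j j).re = (1 - ε) * b j + ε * (R j j).re := by
    intro j
    rw [hWω]
    simp [Matrix.add_apply, Matrix.smul_apply]
  have hsq : ∀ j, (((Wᴴ * ω * W) * (Wᴴ * ω * W)) j j).re =
      (1 - ε) ^ 2 * b j ^ 2 + 2 * (1 - ε) * ε * (b j * (R j j).re) + ε ^ 2 * ((R * R) j j).re := by
    intro j
    rw [hWω]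
    simp only [Matrix.add_mul, Matrix.mul_add, Matrix.smul_mul, Matrix.mul_smul, Matrix.add_apply,
      Matrix.smul_apply, Matrix.diagonal_mul_diagonal, Matrix.diagonal_apply_eq,
      Matrix.diagonal_mul, Matrix.mul_diagonal, smul_eq_mul, Complex.add_re, Complex.re_ofReal_mul,
      Complex.ofReal_re]
    rw [mul_comm (R j j), Complex.re_ofReal_mul]
    ring
  have hz : ∀ j, b j = 0 → ((Wᴴ * ω * W) j j).re = 0 := by
    intro j hj
    rw [hd, hj, h0 j hj]; simp
  have hsum : ∑ j, ((Wᴴ * ω * W) j j).re = 1 := by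
    simp only [hd, Finset.sum_add_distrib, ← Finset.mul_sum, hbs, hRs]; ring
  have hlog : - ∑ j, ((Wᴴ * ω * W) j j).re * Real.log (b j) =
      (1 - ε) * (- ∑ j, b j * Real.log (b j))
          + ε * (- ∑ j, (R j j).re * Real.log (b j)) := by
    simp only [hd]
    simp only [add_mul, Finset.sum_add_distrib, mul_assoc, ← Finset.mul_sum]; ring
  constructor
  · have := klein hωp hW b hb hz (by rw [hbs, hsum])
    rwa [hlog] at this
  · have := chi2 hωp hW b hb hz
    rw [hlog, hsum] at this
    have hdiv : ∑ j, (((Wᴴ * ω * W) * (Wᴴ * ω * W)) j j).re / b j =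
        (1 - ε) ^ 2 + 2 * (1 - ε) * ε + ε ^ 2 * ∑ j, ((R * R) j j).re / b j := by
      have : ∀ j, (((Wᴴ * ω * W) * (Wᴴ * ω * W)) j j).re / b j =
          (1 - ε) ^ 2 * b j + 2 * (1 - ε) * ε * (R j j).re + ε ^ 2 * (((R * R) j j).re / b j) := by
        intro j
        rw [hsq]
        by_cases hj : b j = 0
        · rw [h0 j hj, hj]; simp
        · field_simp
      simp only [this, Finset.sum_add_distrib, ← Finset.mul_sum, hbs, hRs]
      ring
    rw [hdiv] at this
    linarith

open scoped Kronecker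

theorem psd_sqrt {n : Type*} [Fintype n] [DecidableEq n] {X : Matrix n n ℂ}
    (h : X.PosSemidef) : ∃ B : Matrix n n ℂ, X = Bᴴ * B := by
  obtain ⟨V, hV, hX⟩ := spec_form h.1
  refine ⟨Matrix.diagonal (fun i => (Real.sqrt (h.1.eigenvalues i) : ℂ)) * Vᴴ, ?_⟩
  rw [Matrix.conjTranspose_mul, Matrix.conjTranspose_conjTranspose, Matrix.diagonal_conjTranspose]
  conv_lhs => rw [hX]
  rw [Matrix.mul_assoc V (Matrix.diagonal _) (Matrix.diagonal _ * _),
    ← Matrix.mul_assoc (Matrix.diagonal _) (Matrix.diagonal _),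
    Matrix.diagonal_mul_diagonal, Matrix.mul_assoc V]
  congr 3
  ext i
  simp only [Pi.star_apply, RCLike.star_def, Complex.conj_ofReal, ← Complex.ofReal_mul,
    Real.mul_self_sqrt (h.eigenvalues_nonneg i)]

theorem trace_mul_psd {n : Type*} [Fintype n] [DecidableEq n] {X Y : Matrix n n ℂ}
    (hX : X.PosSemidef) (hY : Y.PosSemidef) : 0 ≤ (X * Y).trace := by
  obtain ⟨B, rfl⟩ := psd_sqrt hY
  rw [← Matrix.mul_assoc, Matrix.trace_mul_comm, ← Matrix.mul_assoc]
  exact (hX.mul_mul_conjTranspose_same B).trace_nonneg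

/-- Tensor product of a family of matrices. -/
def tens {n : ℕ} {α β : Type*} (M : Fin n → Matrix α β ℂ) :
    Matrix (Fin n → α) (Fin n → β) ℂ :=
  Matrix.of fun a b => ∏ i, M i (a i) (b i)

theorem tens_mul {n : ℕ} {α β γ : Type*} [Fintype β] (M : Fin n → Matrix α β ℂ)
    (N : Fin n → Matrix β γ ℂ) : tens M * tens N = tens (fun i => M i * N i) := by
  ext a c
  simp only [tens, Matrix.mul_apply, Matrix.of_apply, ← Finset.prod_mul_distrib]
  exact (Fintype.prod_sum (fun i j => M i (a i) j * N i j (c i))).symm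

theorem tens_conj {n : ℕ} {α β : Type*} (M : Fin n → Matrix α β ℂ) :
    (tens M)ᴴ = tens (fun i => (M i)ᴴ) := by
  ext a c
  simp [tens, Matrix.conjTranspose_apply]

theorem tens_diag {n : ℕ} {α : Type*} [DecidableEq α] (g : Fin n → α → ℂ) :
    tens (fun i => Matrix.diagonal (g i)) = Matrix.diagonal (fun a => ∏ i, g i (a i)) := by
  ext a c
  by_cases h : a = c
  · subst h; simp [tens]
  · rw [Matrix.diagonal_apply_ne _ h]
    obtain ⟨i, hi⟩ := Function.ne_iff.mp h
    exact Finset.prod_eq_zero (Finset.mem_univ i) (Matrix.diagonal_apply_ne _ hi)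

theorem tens_one {n : ℕ} {α : Type*} [DecidableEq α] :
    tens (fun _ : Fin n => (1 : Matrix α α ℂ)) = 1 := by
  simp only [← Matrix.diagonal_one, tens_diag]
  simp

theorem tens_trace {n : ℕ} {α : Type*} [Fintype α] (M : Fin n → Matrix α α ℂ) :
    (tens M).trace = ∏ i, (M i).trace := by
  simp only [Matrix.trace, Matrix.diag, tens, Matrix.of_apply]
  exact (Fintype.prod_sum (fun i j => M i j j)).symm

theorem tens_psd {n : ℕ} {α : Type*} [Fintype α] [DecidableEq α] (M : Fin n → Matrix α α ℂ)
    (h : ∀ i, (M i).PosSemidef) : (tens M).PosSemidef := by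
  choose B hB using fun i => psd_sqrt (h i)
  have : tens M = (tens B)ᴴ * tens B := by
    rw [tens_conj, tens_mul]; congr 1; funext i; exact hB i
  rw [this]
  exact Matrix.posSemidef_conjTranspose_mul_self _

/-- Local operator acting on the `i`-th factor. -/
def lift1 {n : ℕ} {α : Type*} [DecidableEq α] (i : Fin n) (X : Matrix α α ℂ) :
    Matrix (Fin n → α) (Fin n → α) ℂ :=
  tens (Function.update (fun _ => 1) i X)

theorem lift1_apply {n : ℕ} {α : Type*} [DecidableEq α] (i : Fin n) (X : Matrix α α ℂ)
    (a b : Fin n → α) : lift1 i X a b =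
      X (a i) (b i) * ∏ k ∈ Finset.univ.erase i, (1 : Matrix α α ℂ) (a k) (b k) := by
  unfold lift1 tens
  rw [Matrix.of_apply, ← Finset.mul_prod_erase _ _ (Finset.mem_univ i)]
  rw [Function.update_self]
  congr 1
  refine Finset.prod_congr rfl fun k hk => ?_
  rw [Function.update_of_ne (Finset.ne_of_mem_erase hk)]

theorem lift1_add {n : ℕ} {α : Type*} [DecidableEq α] (i : Fin n) (X Y : Matrix α α ℂ) :
    lift1 i (X + Y) = lift1 i X + lift1 i Y := by
  ext a b
  simp only [lift1_apply, Matrix.add_apply, add_mul]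

theorem lift1_smul {n : ℕ} {α : Type*} [DecidableEq α] (i : Fin n) (c : ℂ) (X : Matrix α α ℂ) :
    lift1 i (c • X) = c • lift1 i X := by
  ext a b
  simp only [lift1_apply, Matrix.smul_apply, smul_eq_mul, mul_assoc]

theorem update_map {n : ℕ} {α β : Type*} (f : α → β) (i : Fin n) (x y : α) (k : Fin n) :
    f (Function.update (fun _ => x) i y k) = Function.update (fun _ => f x) i (f y) k := by
  by_cases h : k = i
  · subst h; simp
  · simp [Function.update_of_ne h]

theorem lift1_conj {n : ℕ} {α : Type*} [DecidableEq α] (i : Fin n) (X : Matrix α α ℂ) :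
    (lift1 i X)ᴴ = lift1 i Xᴴ := by
  unfold lift1
  rw [tens_conj]
  congr 1
  funext k
  rw [update_map (fun M : Matrix α α ℂ => Mᴴ), Matrix.conjTranspose_one]

theorem lift1_one {n : ℕ} {α : Type*} [DecidableEq α] (i : Fin n) :
    lift1 i (1 : Matrix α α ℂ) = 1 := by
  unfold lift1
  rw [Function.update_eq_self_iff.mpr rfl, tens_one]

theorem lift1_psd {n : ℕ} {α : Type*} [Fintype α] [DecidableEq α] (i : Fin n)
    {X : Matrix α α ℂ} (hX : X.PosSemidef) : (lift1 i X).PosSemidef := by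
  refine tens_psd _ fun k => ?_
  by_cases h : k = i
  · subst h; simpa using hX
  · rw [Function.update_of_ne h]; exact Matrix.PosSemidef.one

theorem lift1_diag {n : ℕ} {α : Type*} [DecidableEq α] (i : Fin n) (g : α → ℂ) :
    lift1 i (Matrix.diagonal g) = Matrix.diagonal (fun J : Fin n → α => g (J i)) := by
  ext a b
  by_cases h : a = b
  · subst h; rw [lift1_apply]; simp
  · rw [Matrix.diagonal_apply_ne _ h, lift1_apply]
    by_cases hi : a i = b i
    · have : ∃ k, a k ≠ b k := Function.ne_iff.mp h
      obtain ⟨k, hk⟩ := this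
      have hki : k ≠ i := fun e => hk (e ▸ hi)
      have hp : ∏ k ∈ Finset.univ.erase i, (1 : Matrix α α ℂ) (a k) (b k) = 0 :=
        Finset.prod_eq_zero (Finset.mem_erase.mpr ⟨hki, Finset.mem_univ k⟩)
          (Matrix.one_apply_ne hk)
      rw [hp, mul_zero]
    · rw [Matrix.diagonal_apply_ne _ hi, zero_mul]

/-- average marginal -/
theorem exists_marg {n : ℕ} (hn : 1 ≤ n) {α : Type*} [Fintype α] [DecidableEq α]
    {ρ : Matrix (Fin n → α) (Fin n → α) ℂ} (hρ : IsState ρ) :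
    ∃ τ : Matrix α α ℂ, IsState τ ∧
      ∀ X, (n : ℂ) * (τ * X).trace = ∑ i, (ρ * lift1 i X).trace := by
  have hn0 : (n : ℂ) ≠ 0 := by exact_mod_cast (by omega : n ≠ 0)
  let L : Matrix α α ℂ →ₗ[ℂ] ℂ :=
    { toFun := fun X => ∑ i, (ρ * lift1 i X).trace
      map_add' := by
        intro X Y
        simp only [lift1_add, Matrix.mul_add, Matrix.trace_add, Finset.sum_add_distrib]
      map_smul' := by
        intro c X
        simp only [lift1_smul, Matrix.mul_smul, Matrix.trace_smul, Finset.smul_sum,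
          RingHom.id_apply] }
  have hLdef : ∀ X, L X = ∑ i, (ρ * lift1 i X).trace := fun X => rfl
  have hLp : ∀ X : Matrix α α ℂ, X.PosSemidef → 0 ≤ L X := by
    intro X hX
    rw [hLdef]
    exact Finset.sum_nonneg fun i _ => trace_mul_psd hρ.1 (lift1_psd i hX)
  have hLc : ∀ X : Matrix α α ℂ, L Xᴴ = star (L X) := by
    intro X
    rw [hLdef, hLdef, star_sum]
    refine Finset.sum_congr rfl fun i _ => ?_
    rw [← Matrix.trace_conjTranspose, Matrix.conjTranspose_mul, hρ.1.1.eq, lift1_conj,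
      Matrix.trace_mul_comm]
  let τ : Matrix α α ℂ := Matrix.of fun x y => (n : ℂ)⁻¹ * L (Matrix.single y x 1)
  have hτ : ∀ X, (n : ℂ) * (τ * X).trace = L X := by
    intro X
    conv_rhs => rw [Matrix.matrix_eq_sum_single X]
    simp only [map_sum]
    rw [Finset.sum_comm]
    simp only [Matrix.trace, Matrix.diag, Matrix.mul_apply, Finset.mul_sum]
    refine Finset.sum_congr rfl fun x _ => Finset.sum_congr rfl fun y _ => ?_
    have : Matrix.single y x (X y x) = X y x • Matrix.single y x (1 : ℂ) := by
      rw [Matrix.smul_single, smul_eq_mul, mul_one]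
    rw [this, map_smul, smul_eq_mul]
    simp only [τ, Matrix.of_apply]
    field_simp
  refine ⟨τ, ⟨?_, ?_⟩, fun X => hτ X⟩
  · refine Matrix.PosSemidef.of_dotProduct_mulVec_nonneg ?_ ?_
    · ext x y
      rw [Matrix.conjTranspose_apply]
      simp only [τ, Matrix.of_apply, star_mul']
      rw [← hLc, Matrix.conjTranspose_single]
      simp
    · intro v
      have h1 : star v ⬝ᵥ (τ *ᵥ v) = (τ * Matrix.vecMulVec v (star v)).trace := by
        rw [Matrix.mul_vecMulVec, Matrix.trace_vecMulVec, dotProduct_comm]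
      have h2 := hLp _ (Matrix.posSemidef_vecMulVec_self_star v)
      rw [← hτ, ← h1] at h2
      have h3 : (0 : ℂ) ≤ (n : ℂ)⁻¹ := by
        rw [inv_nonneg]; exact_mod_cast Nat.zero_le n
      have := mul_nonneg h3 h2
      rwa [← mul_assoc, inv_mul_cancel₀ hn0, one_mul] at this
  · have := hτ 1
    rw [hLdef] at this
    simp only [lift1_one, Matrix.mul_one, hρ.2, Finset.sum_const, Finset.card_univ,
      Fintype.card_fin, nsmul_eq_mul] at this
    exact mul_left_cancel₀ hn0 this

/-- Heisenberg-picture map of `ρ ↦ Tr_E (T ρ T†)`. -/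
def adjB {α β ε : Type*} [Fintype β] [Fintype ε] [DecidableEq ε]
    (T : Matrix (β × ε) α ℂ) (X : Matrix β β ℂ) : Matrix α α ℂ :=
  Tᴴ * (X ⊗ₖ (1 : Matrix ε ε ℂ)) * T

theorem trace_adjB {α β ε : Type*} [Fintype α] [Fintype β] [Fintype ε] [DecidableEq ε]
    (T : Matrix (β × ε) α ℂ) (ρ : Matrix α α ℂ) (X : Matrix β β ℂ) :
    (ptraceSnd (T * ρ * Tᴴ) * X).trace = (ρ * adjB T X).trace := by
  have h : ∀ M : Matrix (β × ε) (β × ε) ℂ,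
      (ptraceSnd M * X).trace = (M * (X ⊗ₖ (1 : Matrix ε ε ℂ))).trace := by
    intro M
    simp only [Matrix.trace, Matrix.diag, Matrix.mul_apply, ptraceSnd, Matrix.of_apply,
      Fintype.sum_prod_type, Matrix.kroneckerMap_apply, Matrix.one_apply, mul_ite, mul_one,
      mul_zero, Finset.sum_ite_eq', Finset.mem_univ, if_true, Finset.sum_mul]
    refine Finset.sum_congr rfl fun b _ => ?_
    rw [Finset.sum_comm]
  rw [h, adjB, Matrix.mul_assoc (T * ρ), Matrix.mul_assoc T, Matrix.trace_mul_comm]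
  simp only [Matrix.mul_assoc]

theorem adjB_one {α β ε : Type*} [Fintype α] [DecidableEq α] [Fintype β] [Fintype ε]
    [DecidableEq ε] [DecidableEq β]
    (T : Matrix (β × ε) α ℂ) (hT : Tᴴ * T = 1) : adjB T 1 = 1 := by
  rw [adjB, Matrix.one_kronecker_one, Matrix.mul_one, hT]

theorem state_chan {α β ε : Type*} [Fintype α] [DecidableEq α] [Fintype β] [Fintype ε]
    [DecidableEq ε] [DecidableEq β]
    (T : Matrix (β × ε) α ℂ) (hT : Tᴴ * T = 1) {ρ : Matrix α α ℂ} (hρ : IsState ρ) :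
    IsState (ptraceSnd (T * ρ * Tᴴ)) := by
  constructor
  · have h := hρ.1.mul_mul_conjTranspose_same T
    have e : ptraceSnd (T * ρ * Tᴴ) =
        ∑ k, (T * ρ * Tᴴ).submatrix (fun b => (b, k)) (fun b => (b, k)) := by
      ext i j
      simp only [ptraceSnd, Matrix.of_apply, Matrix.sum_apply, Matrix.submatrix_apply]
    rw [e]
    exact Matrix.posSemidef_sum _ fun k _ => h.submatrix _
  · have := trace_adjB T ρ 1
    rwa [Matrix.mul_one, adjB_one T hT, Matrix.mul_one, hρ.2] at this

theorem lin_chan {α β ε : Type*} [Fintype α] [Fintype ε]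
    (T : Matrix (β × ε) α ℂ) (ρ σ : Matrix α α ℂ) (c d : ℂ) :
    ptraceSnd (T * (c • σ + d • ρ) * Tᴴ) =
      c • ptraceSnd (T * σ * Tᴴ) + d • ptraceSnd (T * ρ * Tᴴ) := by
  ext i j
  simp only [Matrix.mul_add, Matrix.add_mul, Matrix.mul_smul, Matrix.smul_mul, ptraceSnd,
    Matrix.of_apply, Matrix.add_apply, Matrix.smul_apply, Finset.sum_add_distrib,
    Finset.smul_sum]

/-- Reordering of tensor factors. -/
def reord (n : ℕ) (β ε : Type*) : ((Fin n → β) × (Fin n → ε)) ≃ (Fin n → β × ε) where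
  toFun x i := (x.1 i, x.2 i)
  invFun f := (fun i => (f i).1, fun i => (f i).2)
  left_inv _ := rfl
  right_inv _ := rfl

theorem tpow_eq (U : Matrix (Fin dB × Fin dE) (Fin dA) ℂ) (n : ℕ) :
    tensorPowIso U n = (tens (fun _ : Fin n => U)).submatrix (reord n (Fin dB) (Fin dE)) id := rfl

theorem tpow_iso (U : Matrix (Fin dB × Fin dE) (Fin dA) ℂ) (hU : Uᴴ * U = 1) (n : ℕ) :
    (tensorPowIso U n)ᴴ * tensorPowIso U n = 1 := by
  rw [tpow_eq, Matrix.conjTranspose_submatrix, Matrix.submatrix_mul_equiv, tens_conj, tens_mul]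
  simp only [hU, tens_one]
  rfl

theorem adjB_tens (U : Matrix (Fin dB × Fin dE) (Fin dA) ℂ) (n : ℕ)
    (X : Fin n → Matrix (Fin dB) (Fin dB) ℂ) :
    adjB (tensorPowIso U n) (tens X) = tens (fun i => adjB U (X i)) := by
  have h : (tens X ⊗ₖ (1 : Matrix (Fin n → Fin dE) (Fin n → Fin dE) ℂ)) =
      (tens (fun i => X i ⊗ₖ (1 : Matrix (Fin dE) (Fin dE) ℂ))).submatrix
        (reord n (Fin dB) (Fin dE)) (reord n (Fin dB) (Fin dE)) := by
    ext x y
    rw [← tens_one]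
    simp only [Matrix.kroneckerMap_apply, tens, Matrix.of_apply, Matrix.submatrix_apply, reord,
      Equiv.coe_fn_mk, Finset.prod_mul_distrib]
  rw [adjB, h, tpow_eq, Matrix.conjTranspose_submatrix, Matrix.submatrix_mul_equiv,
    Matrix.submatrix_mul_equiv, tens_conj, tens_mul, tens_mul]
  rfl

theorem chanBn_tens (U : Matrix (Fin dB × Fin dE) (Fin dA) ℂ) (n : ℕ)
    (X : Fin n → Matrix (Fin dA) (Fin dA) ℂ) :
    chanBn U n (tens X) = tens (fun i => chanB U (X i)) := by
  have h : tensorPowIso U n * tens X * (tensorPowIso U n)ᴴ =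
      (tens (fun i => U * X i * Uᴴ)).submatrix
        (reord n (Fin dB) (Fin dE)) (reord n (Fin dB) (Fin dE)) := by
    rw [← tens_mul, ← tens_mul, ← tens_conj]
    rfl
  unfold chanBn
  rw [h]
  ext b b'
  simp only [ptraceSnd, Matrix.of_apply, Matrix.submatrix_apply, tens, reord, Equiv.coe_fn_mk,
    chanB]
  exact (Fintype.prod_sum (fun i j => (U * X i * Uᴴ) (b i, j) (b' i, j))).symm

theorem marg_id (U : Matrix (Fin dB × Fin dE) (Fin dA) ℂ) (hU : Uᴴ * U = 1) (n : ℕ)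
    {ρ : Matrix (Fin n → Fin dA) (Fin n → Fin dA) ℂ} {τ : Matrix (Fin dA) (Fin dA) ℂ}
    (hτ : ∀ X, (n : ℂ) * (τ * X).trace = ∑ i, (ρ * lift1 i X).trace)
    (V : Matrix (Fin dB) (Fin dB) ℂ) (hV : V * Vᴴ = 1) (g : Fin dB → ℂ) :
    ∑ i, ∑ J, ((tens (fun _ : Fin n => V))ᴴ * chanBn U n ρ * tens (fun _ : Fin n => V)) J J
        * g (J i) = n * ∑ j, (Vᴴ * chanB U τ * V) j j * g j := by
  have hd : ∀ {m : Type} [Fintype m] [DecidableEq m] (Y : Matrix m m ℂ) (f : m → ℂ),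
      ∑ j, Y j j * f j = (Y * Matrix.diagonal f).trace := by
    intro m _ _ Y f
    simp only [Matrix.trace, Matrix.diag, Matrix.mul_diagonal]
  have h1 : ∀ i : Fin n,
      ∑ J, ((tens (fun _ : Fin n => V))ᴴ * chanBn U n ρ * tens (fun _ : Fin n => V)) J J
        * g (J i) = (ρ * lift1 i (adjB U (V * Matrix.diagonal g * Vᴴ))).trace := by
    intro i
    rw [hd _ (fun J : Fin n → Fin dB => g (J i)), ← lift1_diag, Matrix.mul_assoc,
      Matrix.mul_assoc, Matrix.trace_mul_comm, Matrix.mul_assoc]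
    have e : tens (fun _ : Fin n => V) * lift1 i (Matrix.diagonal g) *
        (tens (fun _ : Fin n => V))ᴴ = lift1 i (V * Matrix.diagonal g * Vᴴ) := by
      unfold lift1
      rw [tens_conj, tens_mul, tens_mul]
      congr 1
      funext k
      rw [update_map (fun M : Matrix (Fin dB) (Fin dB) ℂ => V * M * Vᴴ), Matrix.mul_one, hV]
    rw [e, chanBn, trace_adjB]
    unfold lift1
    rw [adjB_tens]
    congr 3
    funext k
    rw [update_map (fun M : Matrix (Fin dB) (Fin dB) ℂ => adjB U M), adjB_one U hU]
  simp only [h1]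
  rw [← hτ, hd, ← trace_adjB, chanB]
  congr 1
  rw [Matrix.mul_assoc Vᴴ, Matrix.mul_assoc Vᴴ, Matrix.trace_mul_comm Vᴴ]
  simp only [Matrix.mul_assoc]

theorem side (U : Matrix (Fin dB × Fin dE) (Fin dA) ℂ) (hU : Uᴴ * U = 1) (n : ℕ)
    {ρ : Matrix (Fin n → Fin dA) (Fin n → Fin dA) ℂ} (hρ : IsState ρ)
    {τ : Matrix (Fin dA) (Fin dA) ℂ} (hτs : IsState τ)
    (hτ : ∀ X, (n : ℂ) * (τ * X).trace = ∑ i, (ρ * lift1 i X).trace) :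
    ∃ L C : ℝ, ∀ ε : ℝ, 0 ≤ ε → ε ≤ 1 →
      vnEntropy (chanBn U n (((1 - ε : ℝ) : ℂ) • tens (fun _ => τ) + (ε : ℂ) • ρ)) ≤
        (1 - ε) * L + ε * (n * vnEntropy (chanB U τ)) ∧
      (1 - ε) * L + ε * (n * vnEntropy (chanB U τ)) - ε ^ 2 * C ≤
        vnEntropy (chanBn U n (((1 - ε : ℝ) : ℂ) • tens (fun _ => τ) + (ε : ℂ) • ρ)) := by
  have hB : IsState (chanB U τ) := state_chan U hU hτs
  have hBn : IsState (chanBn U n ρ) := state_chan _ (tpow_iso U hU n) hρ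
  obtain ⟨V, hV, hVB⟩ := spec_form hB.1.1
  have hV' : V * Vᴴ = 1 := mul_eq_one_comm.mp hV
  set b := hB.1.1.eigenvalues with hb
  have hb0 : ∀ j, 0 ≤ b j := hB.1.eigenvalues_nonneg
  set W := tens (fun _ : Fin n => V) with hWdef
  have hW : Wᴴ * W = 1 := by
    rw [hWdef, tens_conj, tens_mul]; simp only [hV, tens_one]
  have hdB : Vᴴ * chanB U τ * V = Matrix.diagonal (fun i => (b i : ℂ)) := by
    conv_lhs => rw [hVB]
    calc _ = (Vᴴ * V) * Matrix.diagonal (fun j => (b j : ℂ)) * (Vᴴ * V) := by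
          simp only [Matrix.mul_assoc]
      _ = _ := by rw [hV]; simp
  have hm := marg_id U hU n hτ V hV'
  rw [← hWdef, hdB] at hm
  set q : (Fin n → Fin dB) → ℝ := fun J => ((Wᴴ * chanBn U n ρ * W) J J).re with hq
  have hq0 : ∀ J, 0 ≤ q J := fun J =>
    (Complex.nonneg_iff.mp (hBn.1.conjTranspose_mul_mul_same W).diag_nonneg).1
  have hmr : ∀ g : Fin dB → ℝ, ∑ i, ∑ J, q J * g (J i) = n * ∑ j, b j * g j := by
    intro g
    have := congrArg Complex.re (hm (fun j => (g j : ℂ)))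
    simp only [Complex.re_sum, Matrix.diagonal_apply_eq, ← Complex.ofReal_mul, Complex.re_mul_ofReal,
      ← Complex.ofReal_sum] at this
    rw [this]
    simp
  have hz : ∀ J : Fin n → Fin dB, ∀ i, b (J i) = 0 → q J = 0 := by
    intro J i hJ
    have h1 := hmr (fun j => if j = J i then 1 else 0)
    simp only [mul_ite, mul_one, mul_zero] at h1
    rw [Finset.sum_ite_eq' Finset.univ (J i)] at h1
    simp only [Finset.mem_univ, if_true, hJ, mul_zero] at h1
    have nn : ∀ (i' : Fin n) (J' : Fin n → Fin dB), 0 ≤ if J' i' = J i then q J' else 0 := by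
      intro i' J'; split_ifs
      · exact hq0 _
      · exact le_rfl
    have h2 := (Finset.sum_eq_zero_iff_of_nonneg
      (fun i' _ => Finset.sum_nonneg fun J' _ => nn i' J')).mp h1 i (Finset.mem_univ _)
    have h3 := (Finset.sum_eq_zero_iff_of_nonneg
      (fun J' _ => nn i J')).mp h2 J (Finset.mem_univ _)
    simpa using h3
  have hσ : chanBn U n (tens (fun _ => τ)) =
      W * Matrix.diagonal (fun J : Fin n → Fin dB => ((∏ i, b (J i) : ℝ) : ℂ)) * Wᴴ := by
    rw [chanBn_tens, hWdef, tens_conj]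
    have := tens_diag (n := n) (fun _ j => (b j : ℂ))
    simp only [Complex.ofReal_prod]
    rw [← this, tens_mul, tens_mul]
    congr 1
    funext i
    exact hVB
  have hts : IsState (tens (fun _ : Fin n => τ)) := by
    refine ⟨tens_psd _ fun _ => hτs.1, ?_⟩
    rw [tens_trace]; simp [hτs.2]
  have hσs : IsState (chanBn U n (tens (fun _ => τ))) := state_chan _ (tpow_iso U hU n) hts
  have hlog : - ∑ J, q J * Real.log (∏ i, b (J i)) = n * vnEntropy (chanB U τ) := by
    have e : ∀ J, q J * Real.log (∏ i, b (J i)) = ∑ i, q J * Real.log (b (J i)) := by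
      intro J
      by_cases h : ∃ i, b (J i) = 0
      · obtain ⟨i, hi⟩ := h
        simp [hz J i hi]
      · push Not at h
        rw [Real.log_prod (fun i _ => h i), Finset.mul_sum]
    simp only [e]
    rw [Finset.sum_comm, hmr (fun j => Real.log (b j)), ent_eq hB.1.1]
    simp only [Real.negMulLog, ← hb, neg_mul, Finset.sum_neg_distrib]
    ring
  obtain ⟨C, hC⟩ := ent_perturb (fun J : Fin n → Fin dB => ∏ i, b (J i))
    (fun J => Finset.prod_nonneg fun i _ => hb0 _) hW hσ hσs.2 hBn (by
      intro J hJ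
      obtain ⟨i, -, hi⟩ := Finset.prod_eq_zero_iff.mp hJ
      exact hz J i hi)
  refine ⟨- ∑ J : Fin n → Fin dB, (∏ i, b (J i)) * Real.log (∏ i, b (J i)), C,
    fun ε h0 h1 => ?_⟩
  have := hC ε h0 h1
  rw [hlog] at this
  have e : chanBn U n (((1 - ε : ℝ) : ℂ) • tens (fun _ => τ) + (ε : ℂ) • ρ) =
    ((1 - ε : ℝ) : ℂ) • chanBn U n (tens (fun _ => τ)) + (ε : ℂ) • chanBn U n ρ :=
    lin_chan _ _ _ _ _
  rw [e]
  exact this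

theorem pure_ent {α β ε : Type*} [Fintype α] [Fintype β] [DecidableEq β] [Fintype ε]
    [DecidableEq ε] (T : Matrix (β × ε) α ℂ) (v : α → ℂ) :
    vnEntropy (ptraceSnd (T * Matrix.vecMulVec v (star v) * Tᴴ)) =
      vnEntropy (ptraceFst (T * Matrix.vecMulVec v (star v) * Tᴴ)) := by
  have h : T * Matrix.vecMulVec v (star v) * Tᴴ =
      Matrix.vecMulVec (T *ᵥ v) (star (T *ᵥ v)) := by
    rw [Matrix.mul_vecMulVec, Matrix.vecMulVec_mul, Matrix.star_mulVec]
  rw [h]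
  set w := T *ᵥ v
  let M : Matrix β ε ℂ := Matrix.of fun b e => w (b, e)
  have h1 : ptraceSnd (Matrix.vecMulVec w (star w)) = M * Mᴴ := by
    ext i j
    simp [ptraceSnd, Matrix.mul_apply, M, Matrix.vecMulVec_apply]
  have h2 : ptraceFst (Matrix.vecMulVec w (star w)) = (Mᴴ * M)ᵀ := by
    ext i j
    simp [ptraceFst, Matrix.mul_apply, M, Matrix.vecMulVec_apply, mul_comm]
  rw [h1, h2, ent_pure]

theorem pure_decomp {α : Type*} [Fintype α] [DecidableEq α] {ρ : Matrix α α ℂ}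
    (hρ : IsState ρ) : ∃ (m : ℕ) (p : Fin m → ℝ) (σ : Fin m → Matrix α α ℂ),
      IsEnsemble p σ ∧ ∑ u, (p u : ℂ) • σ u = ρ ∧
      ∀ u, ∃ v : α → ℂ, σ u = Matrix.vecMulVec v (star v) := by
  obtain ⟨V, hV, hX⟩ := spec_form hρ.1.1
  set a := hρ.1.1.eigenvalues with ha
  let e := (Fintype.equivFin α).symm
  have hsum : ∑ i, (a i : ℂ) • Matrix.vecMulVec (fun k => V k i) (star fun k => V k i) = ρ := by
    conv_rhs => rw [hX]
    ext x y
    rw [Matrix.sum_apply, Matrix.mul_apply]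
    refine Finset.sum_congr rfl fun i _ => ?_
    simp only [Matrix.smul_apply, Matrix.vecMulVec_apply, Matrix.mul_diagonal, Pi.star_apply,
      Matrix.conjTranspose_apply, smul_eq_mul]
    ring
  have htr : ∀ i, (Matrix.vecMulVec (fun k => V k i) (star fun k => V k i)).trace = 1 := by
    intro i
    have := congrFun (congrFun hV i) i
    rw [Matrix.one_apply_eq, Matrix.mul_apply] at this
    rw [← this]
    simp only [Matrix.trace, Matrix.diag, Matrix.vecMulVec_apply, Matrix.conjTranspose_apply,
      Pi.star_apply, mul_comm]
  refine ⟨Fintype.card α, fun u => a (e u),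
    fun u => Matrix.vecMulVec (fun k => V k (e u)) (star fun k => V k (e u)), ⟨?_, ?_, ?_⟩, ?_, ?_⟩
  · exact fun u => hρ.1.eigenvalues_nonneg _
  · rw [Equiv.sum_comp e a]
    have := congrArg Matrix.trace hsum
    rw [Matrix.trace_sum, hρ.2] at this
    simp only [Matrix.trace_smul, htr, smul_eq_mul, mul_one] at this
    exact_mod_cast this
  · exact fun u => ⟨Matrix.posSemidef_vecMulVec_self_star _, htr _⟩
  · rw [Equiv.sum_comp e
      (fun i => (a i : ℂ) • Matrix.vecMulVec (fun k => V k i) (star fun k => V k i)), hsum]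
  · exact fun u => ⟨_, rfl⟩

theorem avg_state {α ι : Type*} [Fintype α] [Fintype ι] {p : ι → ℝ} {σ : ι → Matrix α α ℂ}
    (h : IsEnsemble p σ) : IsState (∑ u, (p u : ℂ) • σ u) := by
  refine ⟨Matrix.posSemidef_sum _ fun u _ => (h.2.2 u).1.smul ?_, ?_⟩
  · exact_mod_cast h.1 u
  · rw [Matrix.trace_sum]
    simp only [Matrix.trace_smul, (h.2.2 _).2, smul_eq_mul, mul_one]
    exact_mod_cast h.2.1

theorem hol_diff (U : Matrix (Fin dB × Fin dE) (Fin dA) ℂ) (n m : ℕ) (p : Fin m → ℝ)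
    (σ : Fin m → Matrix (Fin n → Fin dA) (Fin n → Fin dA) ℂ) :
    holevo (chanBn U n) p σ - holevo (chanEn U n) p σ =
      cohInfoN U n (∑ u, (p u : ℂ) • σ u) - ∑ u, p u * cohInfoN U n (σ u) := by
  unfold holevo cohInfoN
  simp only [mul_sub, Finset.sum_sub_distrib]
  ring

theorem coh_pure (U : Matrix (Fin dB × Fin dE) (Fin dA) ℂ) (n : ℕ) (v : (Fin n → Fin dA) → ℂ) :
    cohInfoN U n (Matrix.vecMulVec v (star v)) = 0 := by
  unfold cohInfoN chanBn chanEn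
  rw [pure_ent, sub_self]

/-- The isometry with the two output systems exchanged. -/
def swapU (U : Matrix (Fin dB × Fin dE) (Fin dA) ℂ) : Matrix (Fin dE × Fin dB) (Fin dA) ℂ :=
  U.submatrix Prod.swap id

theorem swapU_iso (U : Matrix (Fin dB × Fin dE) (Fin dA) ℂ) (hU : Uᴴ * U = 1) :
    (swapU U)ᴴ * swapU U = 1 := by
  have := Matrix.submatrix_mul_equiv Uᴴ U id (Equiv.prodComm (Fin dE) (Fin dB)) id
  rw [hU] at this
  exact this

theorem chanE_swap (U : Matrix (Fin dB × Fin dE) (Fin dA) ℂ) (ρ : Matrix (Fin dA) (Fin dA) ℂ) :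
    chanE U ρ = chanB (swapU U) ρ := rfl

theorem chanEn_swap (U : Matrix (Fin dB × Fin dE) (Fin dA) ℂ) (n : ℕ)
    (ρ : Matrix (Fin n → Fin dA) (Fin n → Fin dA) ℂ) :
    chanEn U n ρ = chanBn (swapU U) n ρ := rfl

theorem cohInfoN_le (U : Matrix (Fin dB × Fin dE) (Fin dA) ℂ) (hU : Uᴴ * U = 1) (n : ℕ)
    {ρ : Matrix (Fin n → Fin dA) (Fin n → Fin dA) ℂ} (hρ : IsState ρ) :
    cohInfoN U n ρ ≤ Fintype.card (Fin n → Fin dB) := by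
  have h1 : IsState (chanBn U n ρ) := state_chan _ (tpow_iso U hU n) hρ
  have h2 : IsState (chanEn U n ρ) := by
    rw [chanEn_swap]; exact state_chan _ (tpow_iso _ (swapU_iso U hU) n) hρ
  have := ent_le h1
  have := ent_nonneg h2
  unfold cohInfoN
  linarith

theorem cohInfo_le (U : Matrix (Fin dB × Fin dE) (Fin dA) ℂ) (hU : Uᴴ * U = 1)
    {ρ : Matrix (Fin dA) (Fin dA) ℂ} (hρ : IsState ρ) :
    cohInfo U ρ ≤ Fintype.card (Fin dB) := by
  have h1 : IsState (chanB U ρ) := state_chan _ hU hρ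
  have h2 : IsState (chanE U ρ) := by
    rw [chanE_swap]; exact state_chan _ (swapU_iso U hU) hρ
  have := ent_le h1
  have := ent_nonneg h2
  unfold cohInfo
  linarith

theorem exists_state {α : Type*} [Fintype α] [DecidableEq α] [Nonempty α] :
    ∃ ρ : Matrix α α ℂ, IsState ρ := by
  obtain ⟨x⟩ := ‹Nonempty α›
  refine ⟨Matrix.diagonal (Pi.single x 1), Matrix.PosSemidef.diagonal ?_, ?_⟩
  · exact Pi.single_nonneg.mpr zero_le_one
  · simp [Matrix.trace_diagonal]

theorem ent_tens_one {d : ℕ} {X : Matrix (Fin d) (Fin d) ℂ} (hX : X.IsHermitian) :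
    vnEntropy (tens (fun _ : Fin 1 => X)) = vnEntropy X := by
  have e : tens (fun _ : Fin 1 => X) =
      Matrix.reindex (Equiv.funUnique (Fin 1) (Fin d)).symm
        (Equiv.funUnique (Fin 1) (Fin d)).symm X := by
    ext a b
    simp [tens]
  refine ent_congr ?_ hX 0 0 ?_
  · rw [e]; exact hX.submatrix _
  · rw [e, Matrix.charpoly_reindex]

/-- Key step: single-letterization of the coherent information. -/
theorem coh_single (U : Matrix (Fin dB × Fin dE) (Fin dA) ℂ) (hU : Uᴴ * U = 1) (n : ℕ)
    (hn : 1 ≤ n)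
    (hln : ∀ (m : ℕ) (p : Fin m → ℝ)
      (σ : Fin m → Matrix (Fin n → Fin dA) (Fin n → Fin dA) ℂ),
      IsEnsemble p σ →
      holevo (chanEn U n) p σ ≤ holevo (chanBn U n) p σ)
    {ρ : Matrix (Fin n → Fin dA) (Fin n → Fin dA) ℂ} (hρ : IsState ρ) :
    ∃ τ, IsState τ ∧ cohInfoN U n ρ ≤ n * cohInfo U τ := by
  obtain ⟨τ, hτs, hτ⟩ := exists_marg hn hρ
  refine ⟨τ, hτs, ?_⟩
  obtain ⟨LB, CB, hB⟩ := side U hU n hρ hτs hτ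
  obtain ⟨LE, CE, hE⟩ := side (swapU U) (swapU_iso U hU) n hρ hτs hτ
  simp only [← chanE_swap, ← chanEn_swap] at hE
  have hts : IsState (tens (fun _ : Fin n => τ)) := by
    refine ⟨tens_psd _ fun _ => hτs.1, ?_⟩
    rw [tens_trace]; simp [hτs.2]
  have hB0 := (hB 0 le_rfl zero_le_one).2
  have hE0 := (hE 0 le_rfl zero_le_one).1
  simp only [sub_zero, Complex.ofReal_one, one_smul, Complex.ofReal_zero, zero_smul, add_zero,
    one_mul, zero_mul, ne_eq, OfNat.ofNat_ne_zero, not_false_eq_true, zero_pow] at hB0 hE0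
  have key : ∀ ε : ℝ, 0 < ε → ε ≤ 1 →
      cohInfoN U n ρ ≤ n * cohInfo U τ + ε * CE := by
    intro ε h0 h1
    have hens : IsEnsemble ![1 - ε, ε] ![tens (fun _ : Fin n => τ), ρ] := by
      refine ⟨?_, ?_, ?_⟩
      · intro u; fin_cases u
        · simpa using h1
        · simpa using h0.le
      · simp
      · intro u; fin_cases u
        · simpa using hts
        · simpa using hρ
    have h := sub_nonneg.mpr (hln 2 _ _ hens)
    rw [hol_diff] at h
    simp only [Fin.sum_univ_two, Matrix.cons_val_zero, Matrix.cons_val_one] at h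
    have h2 := (hB ε h0.le h1).1
    have h3 := (hE ε h0.le h1).2
    have h4 : (1 - ε) * (LB - LE) ≤ (1 - ε) * cohInfoN U n (tens (fun _ : Fin n => τ)) := by
      refine mul_le_mul_of_nonneg_left ?_ (by linarith)
      unfold cohInfoN; linarith
    have h5 : ε * cohInfoN U n ρ ≤ ε * (n * cohInfo U τ + ε * CE) := by
      unfold cohInfo
      unfold cohInfoN at h h4 ⊢
      nlinarith
    exact le_of_mul_le_mul_left h5 h0
  by_contra hcon
  push Not at hcon
  set δ := cohInfoN U n ρ - n * cohInfo U τ with hδ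
  have hδ0 : 0 < δ := by linarith
  have hK : 0 < |CE| + 1 + δ := by positivity
  have h1 := key (δ / (2 * (|CE| + 1 + δ))) (by positivity) (by
    rw [div_le_one (by positivity)]; have := abs_nonneg CE; linarith)
  have h2 : δ / (2 * (|CE| + 1 + δ)) * CE ≤ δ / 2 := by
    have : δ / (2 * (|CE| + 1 + δ)) * CE ≤ δ / (2 * (|CE| + 1 + δ)) * (|CE| + 1 + δ) := by
      refine mul_le_mul_of_nonneg_left ?_ (by positivity)
      have := le_abs_self CE; linarith
    refine this.trans (le_of_eq ?_)
    field_simp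
  linarith

/-- If the channel `N_B` is less noisy (for every `n ≥ 1`, every finite
ensemble of states on `(ℂ^{d_A})^{⊗n}` has Holevo quantity w.r.t. `N_B^{⊗n}` at least that
w.r.t. `N_E^{⊗n}`), then the private and quantum capacities are single-letter characterized:
`C_p(N_B) = Q(N_B) = Q^{(1)}(N_B)`. -/
theorem less_noisy_implies_single_letter
    {dA dB dE : ℕ} (hdA : 1 ≤ dA) (hdB : 1 ≤ dB) (hdE : 1 ≤ dE)
    (U : Matrix (Fin dB × Fin dE) (Fin dA) ℂ) (hU : Uᴴ * U = 1)
    (hln : ∀ n : ℕ, 1 ≤ n → ∀ (m : ℕ) (p : Fin m → ℝ)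
      (σ : Fin m → Matrix (Fin n → Fin dA) (Fin n → Fin dA) ℂ),
      IsEnsemble p σ →
      holevo (chanEn U n) p σ ≤ holevo (chanBn U n) p σ) :
    Cpcap U = Qcap U ∧ Qcap U = Q1 U := by
  haveI : Nonempty (Fin dA) := ⟨⟨0, hdA⟩⟩
  have hbQ1 : BddAbove { r | ∃ ρ, IsState ρ ∧ r = cohInfo U ρ } := by
    refine ⟨Fintype.card (Fin dB), ?_⟩
    rintro r ⟨ρ, hρ, rfl⟩
    exact cohInfo_le U hU hρ
  have hbQn : ∀ n, BddAbove { r | ∃ ρ, IsState ρ ∧ r = cohInfoN U n ρ } := by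
    intro n
    refine ⟨Fintype.card (Fin n → Fin dB), ?_⟩
    rintro r ⟨ρ, hρ, rfl⟩
    exact cohInfoN_le U hU n hρ
  have hneQ1 : { r | ∃ ρ, IsState ρ ∧ r = cohInfo U ρ }.Nonempty := by
    obtain ⟨ρ, hρ⟩ := exists_state (α := Fin dA)
    exact ⟨_, ρ, hρ, rfl⟩
  have hneQn : ∀ n, { r | ∃ ρ, IsState ρ ∧ r = cohInfoN U n ρ }.Nonempty := by
    intro n
    obtain ⟨ρ, hρ⟩ := exists_state (α := Fin n → Fin dA)
    exact ⟨_, ρ, hρ, rfl⟩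
  have hpure : ∀ n, ∀ ρ : Matrix (Fin n → Fin dA) (Fin n → Fin dA) ℂ, IsState ρ →
      ∃ (m : ℕ) (p : Fin m → ℝ) (σ : Fin m → Matrix (Fin n → Fin dA) (Fin n → Fin dA) ℂ),
        IsEnsemble p σ ∧
        cohInfoN U n ρ = holevo (chanBn U n) p σ - holevo (chanEn U n) p σ := by
    intro n ρ hρ
    obtain ⟨m, p, σ, hens, hsum, hp⟩ := pure_decomp hρ
    refine ⟨m, p, σ, hens, ?_⟩
    rw [hol_diff, hsum, Finset.sum_eq_zero, sub_zero]
    intro u _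
    obtain ⟨v, hv⟩ := hp u
    rw [hv, coh_pure, mul_zero]
  have hCpQ : ∀ n : ℕ, 1 ≤ n → Cp1n U n = Q1n U n := by
    intro n hn
    have hnn : ∀ ρ : Matrix (Fin n → Fin dA) (Fin n → Fin dA) ℂ, IsState ρ →
        0 ≤ cohInfoN U n ρ := by
      intro ρ hρ
      obtain ⟨m, p, σ, hens, h⟩ := hpure n ρ hρ
      rw [h]
      exact sub_nonneg.mpr (hln n hn m p σ hens)
    have hup : ∀ r ∈ { r | ∃ (m : ℕ) (p : Fin m → ℝ)
        (σ : Fin m → Matrix (Fin n → Fin dA) (Fin n → Fin dA) ℂ),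
        IsEnsemble p σ ∧ r = holevo (chanBn U n) p σ - holevo (chanEn U n) p σ },
        r ≤ Q1n U n := by
      rintro r ⟨m, p, σ, hens, rfl⟩
      rw [hol_diff]
      have h1 : cohInfoN U n (∑ u, (p u : ℂ) • σ u) ≤ Q1n U n :=
        le_csSup (hbQn n) ⟨_, avg_state hens, rfl⟩
      have h2 : 0 ≤ ∑ u, p u * cohInfoN U n (σ u) :=
        Finset.sum_nonneg fun u _ => mul_nonneg (hens.1 u) (hnn _ (hens.2.2 u))
      linarith
    apply le_antisymm
    · refine csSup_le ?_ hup
      obtain ⟨ρ, hρ⟩ := exists_state (α := Fin n → Fin dA)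
      obtain ⟨m, p, σ, hens, h⟩ := hpure n ρ hρ
      exact ⟨_, m, p, σ, hens, rfl⟩
    · refine csSup_le (hneQn n) ?_
      rintro r ⟨ρ, hρ, rfl⟩
      exact le_csSup ⟨_, hup⟩ (hpure n ρ hρ)
  have hQn : ∀ n : ℕ, 1 ≤ n → Q1n U n / n ≤ Q1 U := by
    intro n hn
    have hn0 : (0 : ℝ) < n := by exact_mod_cast hn
    rw [div_le_iff₀ hn0]
    refine csSup_le (hneQn n) ?_
    rintro r ⟨ρ, hρ, rfl⟩
    obtain ⟨τ, hτ, h⟩ := coh_single U hU n hn (hln n hn) hρ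
    have h1 : cohInfo U τ ≤ Q1 U := le_csSup hbQ1 ⟨τ, hτ, rfl⟩
    rw [mul_comm]
    exact h.trans (mul_le_mul_of_nonneg_left h1 hn0.le)
  constructor
  · unfold Cpcap Qcap
    congr 1
    ext r
    constructor
    · rintro ⟨n, hn, rfl⟩; exact ⟨n, hn, by rw [hCpQ n hn]⟩
    · rintro ⟨n, hn, rfl⟩; exact ⟨n, hn, by rw [hCpQ n hn]⟩
  · have hbd : ∀ r ∈ { r | ∃ n : ℕ, 1 ≤ n ∧ r = Q1n U n / n }, r ≤ Q1 U := by
      rintro r ⟨n, hn, rfl⟩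
      exact hQn n hn
    apply le_antisymm
    · exact csSup_le ⟨_, 1, le_rfl, rfl⟩ hbd
    · have h1 : Q1 U ≤ Q1n U 1 / (1 : ℕ) := by
        rw [Nat.cast_one, div_one]
        refine csSup_le hneQ1 ?_
        rintro r ⟨ρ, hρ, rfl⟩
        refine le_csSup (hbQn 1) ⟨tens (fun _ : Fin 1 => ρ), ?_, ?_⟩
        · refine ⟨tens_psd _ fun _ => hρ.1, ?_⟩
          rw [tens_trace]; simp [hρ.2]
        · unfold cohInfo cohInfoN
          rw [chanEn_swap, chanE_swap, chanBn_tens, chanBn_tens, ent_tens_one, ent_tens_one]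
          · exact (state_chan _ (swapU_iso U hU) hρ).1.1
          · exact (state_chan _ hU hρ).1.1
      exact h1.trans (le_csSup ⟨_, hbd⟩ ⟨1, le_rfl, rfl⟩)

end
end

section
/- Suppose d_A = 2 and C_p^{(1)}(N_B) > 0. Then C_p^{(1)}(N_B) = Q^{(1)}(N_B) if and only if I_c(ρ) ≥ 0 for every state ρ on ℂ^{d_A} (equivalently, every finite ensemble of pure states has Holevo quantity with respect to N_B at least that with respect to N_E). -/
open Matrix BigOperators
open scoped ComplexOrder

noncomputable section

variable {dA dB dE : ℕ}

lemma vnEntropy_eq_sum {n : Type*} [Fintype n] [DecidableEq n] {ρ : Matrix n n ℂ}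
    (h : ρ.IsHermitian) : vnEntropy ρ = ∑ i, Real.negMulLog (h.eigenvalues i) := by
  have hs := h.spectral_theorem
  set V := h.eigenvectorUnitary with hV
  have hVV : (V : Matrix n n ℂ)ᴴ * (V : Matrix n n ℂ) = 1 := by
    rw [← Matrix.star_eq_conjTranspose]; exact Unitary.coe_star_mul_self V
  rw [Unitary.conjStarAlgAut_apply, Matrix.star_eq_conjTranspose] at hs
  have key : ρ * matLog ρ = (V : Matrix n n ℂ) * (Matrix.diagonal (fun i => ((h.eigenvalues i * Real.log (h.eigenvalues i) : ℝ) : ℂ)) * (V : Matrix n n ℂ)ᴴ) := by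
    rw [matLog, dif_pos h]
    nth_rewrite 1 [hs]
    rw [← hV]
    simp only [Matrix.mul_assoc]
    rw [← Matrix.mul_assoc (V : Matrix n n ℂ)ᴴ, hVV, Matrix.one_mul, ← Matrix.mul_assoc (diagonal _) (diagonal _), Matrix.diagonal_mul_diagonal]
    simp
  rw [vnEntropy, key, Matrix.trace_mul_comm, Matrix.mul_assoc, hVV, Matrix.mul_one, Matrix.trace_diagonal, ← Complex.ofReal_sum, Complex.ofReal_re, ← Finset.sum_neg_distrib]
  simp [Real.negMulLog]

lemma vnEntropy_eq_roots {n : Type*} [Fintype n] [DecidableEq n] {ρ : Matrix n n ℂ}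
    (h : ρ.IsHermitian) :
    vnEntropy ρ = (ρ.charpoly.roots.map (fun z : ℂ => Real.negMulLog z.re)).sum := by
  rw [vnEntropy_eq_sum h, h.roots_charpoly_eq_eigenvalues, Multiset.map_map]
  rfl

open Polynomial in
lemma roots_entropy_X_pow {q : ℂ[X]} (hq : q ≠ 0) (k : ℕ) :
    (((X ^ k * q).roots).map (fun z : ℂ => Real.negMulLog z.re)).sum
      = (q.roots.map (fun z : ℂ => Real.negMulLog z.re)).sum := by
  rw [Polynomial.roots_mul (mul_ne_zero (pow_ne_zero _ X_ne_zero) hq)]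
  simp [Multiset.map_nsmul, Multiset.sum_nsmul]

lemma vnEntropy_mul_comm {m n : ℕ} (M : Matrix (Fin m) (Fin n) ℂ) :
    vnEntropy (M * Mᴴ) = vnEntropy (Mᴴ * M)ᵀ := by
  rw [vnEntropy_eq_roots (isHermitian_mul_conjTranspose_self M),
    vnEntropy_eq_roots (isHermitian_conjTranspose_mul_self M).transpose, charpoly_transpose,
    ← roots_entropy_X_pow (charpoly_monic _).ne_zero (Fintype.card (Fin n)), charpoly_mul_comm',
    roots_entropy_X_pow (charpoly_monic _).ne_zero]

lemma cohInfo_pure {dA dB dE : ℕ} (U : Matrix (Fin dB × Fin dE) (Fin dA) ℂ) (ψ : Fin dA → ℂ) :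
    cohInfo U (Matrix.vecMulVec ψ (star ψ)) = 0 := by
  let M : Matrix (Fin dB) (Fin dE) ℂ := Matrix.of fun i k => (U *ᵥ ψ) (i, k)
  have hU : U * vecMulVec ψ (star ψ) * Uᴴ = vecMulVec (U *ᵥ ψ) (star (U *ᵥ ψ)) := by
    rw [Matrix.mul_vecMulVec, Matrix.vecMulVec_mul, Matrix.star_mulVec]
  have hB : chanB U (vecMulVec ψ (star ψ)) = M * Mᴴ := by
    ext i j
    rw [chanB, hU]
    simp [ptraceSnd, Matrix.mul_apply, vecMulVec_apply, M]
  have hE : chanE U (vecMulVec ψ (star ψ)) = (Mᴴ * M)ᵀ := by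
    ext i j
    rw [chanE, hU]
    simp [ptraceFst, Matrix.mul_apply, vecMulVec_apply, M, mul_comm]
  rw [cohInfo, hB, hE, vnEntropy_mul_comm, sub_self]

open scoped Matrix.Norms.L2Operator in
lemma continuous_vnEntropy {X : Type*} [TopologicalSpace X] {n : ℕ}
    {a : X → Matrix (Fin n) (Fin n) ℂ} (ha : Continuous a) (hh : ∀ x, (a x).IsHermitian) :
    Continuous (fun x => vnEntropy (a x)) := by
  have h1 : Continuous (fun x => cfc Real.negMulLog (a x)) :=
    Continuous.cfc_of_mem_nhdsSet (s := Set.univ) Real.negMulLog Filter.univ_mem ha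
      (fun x => (hh x).isSelfAdjoint) Real.continuous_negMulLog.continuousOn
  have h2 : (fun x => vnEntropy (a x)) = fun x => ((cfc Real.negMulLog (a x)).trace).re := by
    funext x
    rw [vnEntropy_eq_sum (hh x), (hh x).cfc_eq, IsHermitian.cfc, Unitary.conjStarAlgAut_apply,
      Matrix.trace_mul_comm, ← Matrix.mul_assoc, Unitary.coe_star_mul_self, Matrix.one_mul,
      Matrix.trace_diagonal]
    simp
  rw [h2]
  exact Complex.continuous_re.comp (Continuous.matrix_trace h1)

lemma ptraceSnd_herm {α β : Type*} [Fintype β] {M : Matrix (α × β) (α × β) ℂ}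
    (h : M.IsHermitian) : (ptraceSnd M).IsHermitian := by
  ext i j
  simp [ptraceSnd, Matrix.conjTranspose_apply]
  exact Finset.sum_congr rfl fun k _ => h.apply _ _

lemma ptraceFst_herm {α β : Type*} [Fintype α] {M : Matrix (α × β) (α × β) ℂ}
    (h : M.IsHermitian) : (ptraceFst M).IsHermitian := by
  ext i j
  simp [ptraceFst, Matrix.conjTranspose_apply]
  exact Finset.sum_congr rfl fun k _ => h.apply _ _

lemma continuous_cohInfo {dA dB dE : ℕ} (U : Matrix (Fin dB × Fin dE) (Fin dA) ℂ) :
    Continuous (fun A : Matrix (Fin dA) (Fin dA) ℂ => cohInfo U (Aᴴ * A)) := by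
  have hc : Continuous (fun A : Matrix (Fin dA) (Fin dA) ℂ => U * (Aᴴ * A) * Uᴴ) := by
    fun_prop
  have hh : ∀ A : Matrix (Fin dA) (Fin dA) ℂ, (U * (Aᴴ * A) * Uᴴ).IsHermitian := fun A =>
    isHermitian_mul_mul_conjTranspose U (isHermitian_conjTranspose_mul_self A)
  unfold cohInfo
  refine Continuous.sub (continuous_vnEntropy ?_ fun A => ptraceSnd_herm (hh A))
    (continuous_vnEntropy ?_ fun A => ptraceFst_herm (hh A))
  · refine continuous_matrix fun i j => ?_
    simp only [chanB, ptraceSnd, Matrix.of_apply]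
    exact continuous_finsetSum _ fun k _ => hc.matrix_elem _ _
  · refine continuous_matrix fun i j => ?_
    simp only [chanE, ptraceFst, Matrix.of_apply]
    exact continuous_finsetSum _ fun k _ => hc.matrix_elem _ _

lemma isState_pure {n : ℕ} {ψ : Fin n → ℂ} (h : star ψ ⬝ᵥ ψ = 1) :
    IsState (vecMulVec ψ (star ψ)) := by
  refine ⟨posSemidef_vecMulVec_self_star ψ, ?_⟩
  rw [Matrix.trace_vecMulVec, dotProduct_comm, h]

lemma psd_decomp {n : ℕ} {M : Matrix (Fin n) (Fin n) ℂ} (h : M.IsHermitian) :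
    ∃ ψ : Fin n → Fin n → ℂ,
      (∀ i, star (ψ i) ⬝ᵥ ψ i = 1) ∧
      M = ∑ i, (h.eigenvalues i : ℂ) • vecMulVec (ψ i) (star (ψ i)) := by
  have hs := h.spectral_theorem
  set V := h.eigenvectorUnitary with hV
  have hVV : (V : Matrix (Fin n) (Fin n) ℂ)ᴴ * (V : Matrix (Fin n) (Fin n) ℂ) = 1 := by
    rw [← Matrix.star_eq_conjTranspose]; exact Unitary.coe_star_mul_self V
  refine ⟨fun i j => (V : Matrix (Fin n) (Fin n) ℂ) j i, fun i => ?_, ?_⟩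
  · have := congrFun (congrFun hVV i) i
    rw [Matrix.mul_apply, Matrix.one_apply_eq] at this
    simpa [dotProduct] using this
  · conv_lhs => rw [hs]
    ext a b
    rw [Unitary.conjStarAlgAut_apply, Matrix.mul_apply, Matrix.sum_apply]
    refine Finset.sum_congr rfl fun i _ => ?_
    simp [Matrix.mul_diagonal, vecMulVec_apply]
    ring

lemma sum_eigenvalues_eq {n : ℕ} {M : Matrix (Fin n) (Fin n) ℂ} (h : M.IsHermitian) {r : ℝ}
    (ht : M.trace = r) : ∑ i, h.eigenvalues i = r := by
  have := h.trace_eq_sum_eigenvalues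
  rw [ht] at this
  simp only [Complex.coe_algebraMap] at this
  exact_mod_cast this.symm

lemma holevo_diff {dA dB dE m : ℕ} (U : Matrix (Fin dB × Fin dE) (Fin dA) ℂ) (p : Fin m → ℝ)
    (σ : Fin m → Matrix (Fin dA) (Fin dA) ℂ) :
    holevo (chanB U) p σ - holevo (chanE U) p σ
      = cohInfo U (∑ u, (p u : ℂ) • σ u) - ∑ u, p u * cohInfo U (σ u) := by
  simp only [holevo, cohInfo, mul_sub, Finset.sum_sub_distrib]
  ring

open scoped MatrixOrder Matrix.Norms.L2Operator in
lemma psd_eq {n : ℕ} {M : Matrix (Fin n) (Fin n) ℂ} (h : M.PosSemidef) :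
    ∃ A : Matrix (Fin n) (Fin n) ℂ, M = Aᴴ * A :=
  CStarAlgebra.nonneg_iff_eq_star_mul_self.mp (Matrix.nonneg_iff_posSemidef.mpr h)

lemma exists_max {dA dB dE : ℕ} (U : Matrix (Fin dB × Fin dE) (Fin dA) ℂ)
    (hne : ∃ ρ : Matrix (Fin dA) (Fin dA) ℂ, IsState ρ) :
    ∃ ρ, IsState ρ ∧ ∀ σ, IsState σ → cohInfo U σ ≤ cohInfo U ρ := by
  let S : Set (Matrix (Fin dA) (Fin dA) ℂ) := {A | (Aᴴ * A).trace = 1}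
  have hcl : IsClosed S := isClosed_eq (by fun_prop) continuous_const
  have hsub : S ⊆ Set.univ.pi fun _ : Fin dA => Set.univ.pi fun _ : Fin dA =>
      Metric.closedBall (0 : ℂ) 1 := by
    intro A hA i _ j _
    have hA' : (Aᴴ * A).trace = 1 := hA
    have h1 : ∑ j, ∑ i, ‖A i j‖ ^ 2 = 1 := by
      have : (Aᴴ * A).trace = ((∑ j, ∑ i, ‖A i j‖ ^ 2 : ℝ) : ℂ) := by
        simp [Matrix.trace, Matrix.mul_apply, Complex.conj_mul']
      rw [this] at hA'
      exact_mod_cast hA'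
    have h2 : ‖A i j‖ ^ 2 ≤ 1 := by
      rw [← h1]
      exact (Finset.single_le_sum (f := fun i => ‖A i j‖ ^ 2) (fun _ _ => by positivity)
        (Finset.mem_univ i)).trans
        (Finset.single_le_sum (f := fun j => ∑ i, ‖A i j‖ ^ 2) (fun _ _ => by positivity)
        (Finset.mem_univ j))
    rw [mem_closedBall_zero_iff]
    nlinarith [norm_nonneg (A i j)]
  have hcomp : IsCompact S :=
    IsCompact.of_isClosed_subset (isCompact_univ_pi fun _ => isCompact_univ_pi fun _ =>
      isCompact_closedBall _ _) hcl hsub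
  obtain ⟨ρ0, h0, h0t⟩ := hne
  obtain ⟨A0, rfl⟩ := psd_eq h0
  obtain ⟨A, hA, hmax⟩ := hcomp.exists_isMaxOn ⟨A0, h0t⟩ (continuous_cohInfo U).continuousOn
  refine ⟨Aᴴ * A, ⟨posSemidef_conjTranspose_mul_self A, hA⟩, ?_⟩
  rintro σ ⟨hσ, hσt⟩
  obtain ⟨B, rfl⟩ := psd_eq hσ
  exact hmax hσt

open scoped MatrixOrder in
lemma psd_sub {n : ℕ} {ρ σ : Matrix (Fin n) (Fin n) ℂ} (hρ : ρ.PosSemidef) (hσ : IsState σ)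
    {t : ℝ} (ht0 : 0 ≤ t) (ht : ∀ i, t ≤ hρ.1.eigenvalues i) :
    (ρ - (t : ℂ) • σ).PosSemidef := by
  have h1 : algebraMap ℝ (Matrix (Fin n) (Fin n) ℂ) t ≤ ρ := by
    rw [algebraMap_le_iff_le_spectrum (a := ρ) (ha := hρ.1.isSelfAdjoint)]
    rw [hρ.1.spectrum_real_eq_range_eigenvalues]
    rintro _ ⟨i, rfl⟩
    exact ht i
  have h2 : σ ≤ algebraMap ℝ (Matrix (Fin n) (Fin n) ℂ) 1 := by
    rw [le_algebraMap_iff_spectrum_le (a := σ) (ha := hσ.1.1.isSelfAdjoint)]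
    rw [hσ.1.1.spectrum_real_eq_range_eigenvalues]
    rintro _ ⟨i, rfl⟩
    rw [← sum_eigenvalues_eq hσ.1.1 (r := 1) (by simpa using hσ.2)]
    exact Finset.single_le_sum (fun j _ => hσ.1.eigenvalues_nonneg j) (Finset.mem_univ i)
  rw [Matrix.le_iff] at h1 h2
  have h3 := h1.add (h2.smul (show (0 : ℂ) ≤ (t : ℂ) by exact_mod_cast ht0))
  have h4 : ρ - (t : ℂ) • σ = ρ - (algebraMap ℝ (Matrix (Fin n) (Fin n) ℂ)) t +
      (t : ℂ) • ((algebraMap ℝ (Matrix (Fin n) (Fin n) ℂ)) 1 - σ) := by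
    rw [Algebra.algebraMap_eq_smul_one, Algebra.algebraMap_eq_smul_one, smul_sub]
    ext i j
    simp
  rw [h4]
  exact h3

theorem qubit_Cp1_eq_Q1_iff_nonneg_cohInfo
    {dB dE : ℕ} (hdB : 1 ≤ dB) (hdE : 1 ≤ dE)
    (U : Matrix (Fin dB × Fin dE) (Fin 2) ℂ) (hU : Uᴴ * U = 1)
    (hCp : 0 < Cp1 U) :
    Cp1 U = Q1 U ↔ ∀ ρ : Matrix (Fin 2) (Fin 2) ℂ, IsState ρ → 0 ≤ cohInfo U ρ := by
  have hbdd : BddAbove { r | ∃ (m : ℕ) (p : Fin m → ℝ) (σ : Fin m → Matrix (Fin 2) (Fin 2) ℂ),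
      IsEnsemble p σ ∧ r = holevo (chanB U) p σ - holevo (chanE U) p σ } := by
    by_contra h
    rw [Cp1, Real.sSup_of_not_bddAbove h] at hCp
    exact lt_irrefl _ hCp
  have hne : ∃ ρ : Matrix (Fin 2) (Fin 2) ℂ, IsState ρ :=
    ⟨_, isState_pure (ψ := ![1, 0]) (by simp [dotProduct])⟩
  obtain ⟨ρ, hρ, hmax⟩ := exists_max U hne
  have hQ : Q1 U = cohInfo U ρ := by
    apply IsGreatest.csSup_eq
    refine ⟨⟨ρ, hρ, rfl⟩, ?_⟩
    rintro _ ⟨σ, hσ, rfl⟩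
    exact hmax σ hσ
  have hle : ∀ (m : ℕ) (p : Fin m → ℝ) (σ : Fin m → Matrix (Fin 2) (Fin 2) ℂ),
      IsEnsemble p σ → cohInfo U (∑ u, (p u : ℂ) • σ u) - ∑ u, p u * cohInfo U (σ u) ≤ Cp1 U :=
    fun m p σ h => le_csSup hbdd ⟨m, p, σ, h, (holevo_diff U p σ).symm⟩
  obtain ⟨ψ, hψ, hdec⟩ := psd_decomp hρ.1.1
  have hsum : ∑ i, hρ.1.1.eigenvalues i = 1 :=
    sum_eigenvalues_eq hρ.1.1 (by simpa using hρ.2)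
  constructor
  · intro heq
    by_contra hcon
    push Not at hcon
    obtain ⟨τ, hτ, hneg⟩ := hcon
    have hpos : 0 < cohInfo U ρ := by rw [← hQ, ← heq]; exact hCp
    have hev : ∀ i, 0 < hρ.1.1.eigenvalues i := by
      intro i
      refine lt_of_le_of_ne (hρ.1.eigenvalues_nonneg i) fun h0 => ?_
      have : ∃ j, ρ = vecMulVec (ψ j) (star (ψ j)) := by
        rw [Fin.sum_univ_two] at hdec hsum
        fin_cases i
        · simp only [Fin.zero_eta, Fin.isValue] at h0
          rw [← h0, zero_add] at hsum
          exact ⟨1, by rw [← h0, hsum] at hdec; simpa using hdec⟩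
        · simp only [Fin.mk_one, Fin.isValue] at h0
          rw [← h0, add_zero] at hsum
          exact ⟨0, by rw [← h0, hsum] at hdec; simpa using hdec⟩
      obtain ⟨j, hj⟩ := this
      rw [hj, cohInfo_pure] at hpos
      exact lt_irrefl _ hpos
    set t := min (hρ.1.1.eigenvalues 0) (hρ.1.1.eigenvalues 1) with ht
    have htpos : 0 < t := lt_min (hev 0) (hev 1)
    have hpsd := psd_sub hρ.1 hτ htpos.le (fun i => by
      fin_cases i
      · exact min_le_left _ _
      · exact min_le_right _ _)
    obtain ⟨φ, hφ, hdec2⟩ := psd_decomp hpsd.1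
    have hsum2 : ∑ i, hpsd.1.eigenvalues i = 1 - t :=
      sum_eigenvalues_eq hpsd.1 (by simp [Matrix.trace_sub, Matrix.trace_smul, hρ.2, hτ.2])
    have := hle 3 (Fin.cons t hpsd.1.eigenvalues)
      (Fin.cons τ (fun i => vecMulVec (φ i) (star (φ i)))) ⟨?_, ?_, ?_⟩
    · rw [Fin.sum_univ_succ (n := 2), Fin.sum_univ_succ (n := 2)] at this
      simp only [Fin.cons_zero, Fin.cons_succ, cohInfo_pure, mul_zero, Finset.sum_const_zero,
        add_zero, ← hdec2, add_sub_cancel] at this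
      rw [heq, hQ] at this
      nlinarith
    · intro u
      refine Fin.cases ?_ (fun i => ?_) u
      · simpa using htpos.le
      · simpa using hpsd.eigenvalues_nonneg i
    · rw [Fin.sum_univ_succ]
      simp only [Fin.cons_zero, Fin.cons_succ, hsum2]
      ring
    · intro u
      refine Fin.cases ?_ (fun i => ?_) u
      · simpa using hτ
      · simpa using isState_pure (hφ i)
  · intro hnn
    apply le_antisymm
    · refine Real.sSup_le ?_ (hQ ▸ hnn ρ hρ)
      rintro _ ⟨m, p, σ, ⟨hp, hp1, hσ⟩, rfl⟩
      rw [holevo_diff, hQ]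
      have h1 : 0 ≤ ∑ u, p u * cohInfo U (σ u) :=
        Finset.sum_nonneg fun u _ => mul_nonneg (hp u) (hnn _ (hσ u))
      have h2 := hmax (∑ u, (p u : ℂ) • σ u) ⟨?_, ?_⟩
      · linarith
      · exact Matrix.posSemidef_sum _ fun u _ =>
          (hσ u).1.smul (show (0 : ℂ) ≤ (p u : ℂ) by exact_mod_cast hp u)
      · rw [Matrix.trace_sum]
        simp only [Matrix.trace_smul, (hσ _).2, smul_eq_mul, mul_one]
        exact_mod_cast hp1
    · rw [hQ]
      have := hle 2 hρ.1.1.eigenvalues (fun i => vecMulVec (ψ i) (star (ψ i)))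
        ⟨hρ.1.eigenvalues_nonneg, hsum, fun i => isState_pure (hψ i)⟩
      rw [← hdec] at this
      simpa [cohInfo_pure] using this

end
end

section
/- The following are equivalent: (i) for every finite ensemble of states on ℂ^{d_A}, the Holevo quantity with respect to N_B is at least the Holevo quantity with respect to N_E; (ii) the channel is less divergence contracting at n = 1, i.e. for all states ρ, ρ̂ on ℂ^{d_A} such that the support of N_B(ρ) is contained in the support of N_B(ρ̂) and the support of N_E(ρ) is contained in the support of N_E(ρ̂), one has D(N_B(ρ) ‖ N_B(ρ̂)) ≥ D(N_E(ρ) ‖ N_E(ρ̂)). -/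
open Matrix BigOperators
open scoped ComplexOrder

noncomputable section

variable {dA dB dE : ℕ}

/-- Functional calculus for a Hermitian matrix. -/
def hfun {n : Type*} [Fintype n] [DecidableEq n] {ρ : Matrix n n ℂ} (h : ρ.IsHermitian)
    (f : ℝ → ℝ) : Matrix n n ℂ :=
  (h.eigenvectorUnitary : Matrix n n ℂ) * Matrix.diagonal (fun i => (f (h.eigenvalues i) : ℂ)) *
      (h.eigenvectorUnitary : Matrix n n ℂ)ᴴ

section
variable {n : Type*} [Fintype n] [DecidableEq n] {ρ σ : Matrix n n ℂ}

lemma matLog_eq (h : ρ.IsHermitian) : matLog ρ = hfun h Real.log := by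
  simp [matLog, hfun, h]

lemma hfun_id (h : ρ.IsHermitian) : hfun h (fun x => x) = ρ := by
  conv_rhs => rw [h.spectral_theorem]
  simp [hfun, Unitary.conjStarAlgAut_apply, Matrix.star_eq_conjTranspose, Function.comp_def]

lemma uu (h : ρ.IsHermitian) : (h.eigenvectorUnitary : Matrix n n ℂ)ᴴ *
    (h.eigenvectorUnitary : Matrix n n ℂ) = 1 := by
  rw [← Matrix.star_eq_conjTranspose]; exact Unitary.coe_star_mul_self _

lemma uu' (h : ρ.IsHermitian) : (h.eigenvectorUnitary : Matrix n n ℂ) *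
    (h.eigenvectorUnitary : Matrix n n ℂ)ᴴ = 1 := by
  rw [← Matrix.star_eq_conjTranspose]; exact Unitary.coe_mul_star_self _

lemma hfun_one (h : ρ.IsHermitian) : hfun h (fun _ => 1) = 1 := by
  simp [hfun, uu']

lemma hfun_mul (h : ρ.IsHermitian) (f g : ℝ → ℝ) :
    hfun h f * hfun h g = hfun h (fun x => f x * g x) := by
  unfold hfun
  have : ∀ V D E W : Matrix n n ℂ, W * V = 1 → V * D * W * (V * E * W) = V * (D * E) * W := by
    intro V D E W hW
    calc V * D * W * (V * E * W) = V * D * (W * V) * E * W := by simp only [Matrix.mul_assoc]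
      _ = _ := by rw [hW]; simp only [Matrix.mul_assoc, Matrix.one_mul]
  rw [this _ _ _ _ (uu h), Matrix.diagonal_mul_diagonal]
  simp

lemma hfun_add (h : ρ.IsHermitian) (f g : ℝ → ℝ) :
    hfun h f + hfun h g = hfun h (fun x => f x + g x) := by
  simp [hfun, ← Matrix.add_mul, ← Matrix.mul_add, Matrix.diagonal_add]

lemma hfun_herm (h : ρ.IsHermitian) (f : ℝ → ℝ) : (hfun h f)ᴴ = hfun h f := by
  simp only [hfun, Matrix.conjTranspose_mul, Matrix.conjTranspose_conjTranspose, Matrix.mul_assoc,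
    Matrix.diagonal_conjTranspose]
  congr 3
  ext i; simp

/-- overlap weights -/
def ovl (h : ρ.IsHermitian) (k : σ.IsHermitian) (i j : n) : ℝ :=
  Complex.normSq (((h.eigenvectorUnitary : Matrix n n ℂ)ᴴ * (k.eigenvectorUnitary : Matrix n n ℂ)) i j)

lemma trace_hfun (h : ρ.IsHermitian) (k : σ.IsHermitian) (f g : ℝ → ℝ) :
    (hfun h f * hfun k g).trace.re =
      ∑ i, ∑ j, ovl h k i j * (f (h.eigenvalues i) * g (k.eigenvalues j)) := by
  unfold hfun ovl
  generalize (h.eigenvectorUnitary : Matrix n n ℂ) = V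
  generalize (k.eigenvectorUnitary : Matrix n n ℂ) = W
  generalize h.eigenvalues = a
  generalize k.eigenvalues = b
  set M := Vᴴ * W with hM
  have hM' : Wᴴ * V = Mᴴ := by simp [hM]
  have : (V * diagonal (fun i => (f (a i) : ℂ)) * Vᴴ * (W * diagonal (fun i => (g (b i) : ℂ)) * Wᴴ)).trace
      = (diagonal (fun i => (f (a i) : ℂ)) * M * (diagonal (fun i => (g (b i) : ℂ)) * Mᴴ)).trace := by
    rw [← hM', hM, Matrix.mul_assoc, Matrix.mul_assoc, Matrix.trace_mul_comm]
    simp only [Matrix.mul_assoc]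
  rw [this]
  simp only [Matrix.trace, Matrix.diag, Matrix.mul_apply (M := diagonal _ * M), Matrix.diagonal_mul,
    Matrix.conjTranspose_apply, Complex.re_sum]
  refine Finset.sum_congr rfl fun i _ => Finset.sum_congr rfl fun j _ => ?_
  simp [Complex.normSq_apply]
  ring

lemma ovl_nonneg (h : ρ.IsHermitian) (k : σ.IsHermitian) (i j : n) : 0 ≤ ovl h k i j :=
  Complex.normSq_nonneg _

lemma relEntropy_eq (h : ρ.IsHermitian) (k : σ.IsHermitian) : relEntropy ρ σ =
    ∑ i, ∑ j, ovl h k i j * (h.eigenvalues i * (Real.log (h.eigenvalues i) - Real.log (k.eigenvalues j))) := by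
  have h1 := trace_hfun h k (fun x => x * Real.log x) (fun _ => 1)
  have h2 := trace_hfun h k (fun x => x) Real.log
  rw [hfun_one, Matrix.mul_one, ← hfun_mul, hfun_id] at h1
  rw [hfun_id] at h2
  unfold relEntropy
  rw [matLog_eq h, matLog_eq k, Matrix.mul_sub, Matrix.trace_sub, Complex.sub_re, h1, h2]
  simp only [← Finset.sum_sub_distrib]
  refine Finset.sum_congr rfl fun i _ => Finset.sum_congr rfl fun j _ => ?_
  ring

lemma ovl_zero (h : ρ.PosSemidef) (k : σ.IsHermitian) (hX : ∃ X, ρ = σ * X) (i j : n)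
    (hi : h.1.eigenvalues i ≠ 0) (hj : k.eigenvalues j = 0) : ovl h.1 k i j = 0 := by
  obtain ⟨X, hX⟩ := hX
  have h2 := trace_hfun h.1 k (fun x => x) (fun x => if x = 0 then 1 else 0)
  have h3 : hfun k (fun x => if x = 0 then 1 else 0) * σ = 0 := by
    have e : hfun k (fun x => if x = 0 then 1 else 0) * hfun k (fun x => x) = 0 := by
      rw [hfun_mul]
      have : (fun x : ℝ => (if x = 0 then (1:ℝ) else 0) * x) = fun _ => 0 := by
        ext x; by_cases hx : x = 0 <;> simp [hx]
      rw [this]; simp [hfun]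
    rwa [hfun_id] at e
  rw [hfun_id, Matrix.trace_mul_comm] at h2
  have h4 : hfun k (fun x => if x = 0 then 1 else 0) * ρ = 0 := by
    rw [hX, ← Matrix.mul_assoc, h3, Matrix.zero_mul]
  rw [h4] at h2
  have nn : ∀ i j, 0 ≤ ovl h.1 k i j * (h.1.eigenvalues i * (if k.eigenvalues j = 0 then 1 else 0)) := by
    intro i j
    refine mul_nonneg (ovl_nonneg _ _ _ _) (mul_nonneg (h.eigenvalues_nonneg i) ?_)
    split_ifs <;> norm_num
  have h5 := (Finset.sum_eq_zero_iff_of_nonneg (fun i _ => Finset.sum_nonneg fun j _ => nn i j)).1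
    (by simpa using h2.symm) i (Finset.mem_univ _)
  have h6 := (Finset.sum_eq_zero_iff_of_nonneg (fun j _ => nn i j)).1 h5 j (Finset.mem_univ _)
  simpa [hi, hj] using h6

lemma klein_s7 (h : ρ.PosSemidef) (k : σ.PosSemidef) (hX : ∃ X, ρ = σ * X) (ht : ρ.trace = σ.trace) :
    0 ≤ relEntropy ρ σ := by
  have h1 := trace_hfun h.1 k.1 (fun x => x) (fun _ => 1)
  have h2 := trace_hfun h.1 k.1 (fun _ => 1) (fun x => x)
  rw [hfun_id, hfun_one, Matrix.mul_one] at h1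
  rw [hfun_id, hfun_one, Matrix.one_mul] at h2
  have : (0:ℝ) = ρ.trace.re - σ.trace.re := by rw [ht]; ring
  rw [this, h1, h2, relEntropy_eq h.1 k.1]
  simp only [← Finset.sum_sub_distrib]
  refine Finset.sum_le_sum fun i _ => Finset.sum_le_sum fun j _ => ?_
  rw [← mul_sub]
  rcases (h.eigenvalues_nonneg i).eq_or_lt with hi | hi
  · rw [← hi]
    have := mul_nonneg (ovl_nonneg h.1 k.1 i j) (k.eigenvalues_nonneg j)
    simp; linarith
  rcases (k.eigenvalues_nonneg j).eq_or_lt with hj | hj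
  · rw [ovl_zero h k.1 hX i j hi.ne' hj.symm]; simp
  refine mul_le_mul_of_nonneg_left ?_ (ovl_nonneg _ _ _ _)
  have := Real.log_le_sub_one_of_pos (div_pos hj hi)
  rw [Real.log_div hj.ne' hi.ne'] at this
  have := mul_le_mul_of_nonneg_left this hi.le
  have e : h.1.eigenvalues i * (k.1.eigenvalues j / h.1.eigenvalues i - 1) =
    k.1.eigenvalues j - h.1.eigenvalues i := by field_simp
  linarith

lemma chisq (h : ρ.PosSemidef) (k : σ.PosSemidef) (hX : ∃ X, ρ = σ * X) :
    relEntropy ρ σ ≤ (ρ * ρ * hfun k.1 (fun x => x⁻¹)).trace.re - ρ.trace.re := by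
  have h1 := trace_hfun h.1 k.1 (fun x => x) (fun _ => 1)
  have h2 := trace_hfun h.1 k.1 (fun x => x * x) (fun x => x⁻¹)
  rw [hfun_id, hfun_one, Matrix.mul_one] at h1
  rw [← hfun_mul, hfun_id] at h2
  rw [h1, h2, relEntropy_eq h.1 k.1]
  simp only [← Finset.sum_sub_distrib]
  refine Finset.sum_le_sum fun i _ => Finset.sum_le_sum fun j _ => ?_
  rw [← mul_sub]
  rcases (h.eigenvalues_nonneg i).eq_or_lt with hi | hi
  · rw [← hi]; simp
  rcases (k.eigenvalues_nonneg j).eq_or_lt with hj | hj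
  · rw [ovl_zero h k.1 hX i j hi.ne' hj.symm]; simp
  refine mul_le_mul_of_nonneg_left ?_ (ovl_nonneg _ _ _ _)
  have := Real.log_le_sub_one_of_pos (div_pos hi hj)
  rw [Real.log_div hi.ne' hj.ne'] at this
  have := mul_le_mul_of_nonneg_left this hi.le
  refine this.trans (le_of_eq ?_)
  field_simp

lemma supp_exists (h : suppLE ρ σ) : ∃ X, ρ = σ * X := by
  have : ∀ j : n, ∃ x : n → ℂ, σ *ᵥ x = ρ *ᵥ (Pi.single j 1) := fun j => by
    obtain ⟨x, hx⟩ := h ⟨Pi.single j 1, rfl⟩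
    exact ⟨x, by simpa using hx⟩
  choose x hx using this
  refine ⟨Matrix.of fun i j => x j i, ?_⟩
  ext i j
  have := congrFun (hx j) i
  simp only [Matrix.mulVec_single_one, Matrix.col_apply] at this
  rw [← this]
  rfl

lemma exists_supp (h : ∃ X, ρ = σ * X) : suppLE ρ σ := by
  obtain ⟨X, rfl⟩ := h
  unfold suppLE
  rw [Matrix.toLin'_mul]
  exact LinearMap.range_comp_le_range _ _

lemma pinv (k : σ.IsHermitian) : hfun k (fun x => x⁻¹) * σ * σ = σ := by
  have e : hfun k (fun x => x⁻¹) * hfun k (fun x => x) * hfun k (fun x => x) = hfun k (fun x => x) := by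
    rw [hfun_mul, hfun_mul]
    congr 1; ext x
    by_cases hx : x = 0 <;> simp [hx]
  simpa only [hfun_id] using e

lemma pinv_comm (k : σ.IsHermitian) : σ * hfun k (fun x => x⁻¹) = hfun k (fun x => x⁻¹) * σ := by
  have e : hfun k (fun x => x) * hfun k (fun x => x⁻¹) = hfun k (fun x => x⁻¹) * hfun k (fun x => x) := by
    rw [hfun_mul, hfun_mul]
    congr 1; ext x; ring
  simpa only [hfun_id] using e

open scoped MatrixOrder Matrix.Norms.L2Operator in
lemma psd_factor {A : Matrix n n ℂ} (hA : A.PosSemidef) : ∃ L : Matrix n n ℂ, A = Lᴴ * L := by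
  obtain ⟨B, hB⟩ := CStarAlgebra.nonneg_iff_eq_star_mul_self.mp hA.nonneg
  exact ⟨B, hB⟩

lemma supp_of_add {A C : Matrix n n ℂ} (hA : A.PosSemidef) (hC : C.PosSemidef) (p : ℝ) (hp : 0 < p)
    (hs : σ = (p : ℂ) • A + C) : ∃ X, A = σ * X := by
  have k : σ.IsHermitian := by
    rw [hs]
    exact ((hA.smul (by exact_mod_cast hp.le : (0:ℂ) ≤ (p:ℂ))).add hC).1
  set Q := hfun k (fun x => if x = 0 then 1 else 0) with hQ
  set S := hfun k (fun x => x⁻¹) with hS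
  have hPQ : σ * S + Q = 1 := by
    have e : hfun k (fun x => x) * S + Q = 1 := by
      rw [hS, hQ, hfun_mul, hfun_add, ← hfun_one k]
      congr 1; ext x
      by_cases hx : x = 0 <;> simp [hx]
    rwa [hfun_id] at e
  have hσQ : σ * Q = 0 := by
    have e : hfun k (fun x => x) * Q = 0 := by
      rw [hQ, hfun_mul]
      have : (fun x : ℝ => x * (if x = 0 then (1:ℝ) else 0)) = fun _ => 0 := by
        ext x; by_cases hx : x = 0 <;> simp [hx]
      rw [this]; simp [hfun]
    rwa [hfun_id] at e
  have hQH : Qᴴ = Q := hfun_herm _ _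
  have h1 : (p : ℂ) • (Qᴴ * A * Q) + Qᴴ * C * Q = 0 := by
    have : Qᴴ * σ * Q = 0 := by rw [Matrix.mul_assoc, hσQ, Matrix.mul_zero]
    rw [← this, hs]
    simp [Matrix.mul_add, Matrix.add_mul]
  have pA := hA.conjTranspose_mul_mul_same Q
  have pC := hC.conjTranspose_mul_mul_same Q
  have tA := pA.trace_nonneg
  have tC := pC.trace_nonneg
  have t := congrArg Matrix.trace h1
  simp only [Matrix.trace_add, Matrix.trace_smul, Matrix.trace_zero, smul_eq_mul] at t
  have hpA : (0:ℂ) ≤ p * (Qᴴ * A * Q).trace := mul_nonneg (by exact_mod_cast hp.le) tA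
  have t0 : (p:ℂ) * (Qᴴ * A * Q).trace = 0 := by
    refine le_antisymm ?_ hpA
    rw [← t]; exact le_add_of_nonneg_right tC
  have t1 : (Qᴴ * A * Q).trace = 0 := by
    rcases mul_eq_zero.1 t0 with h | h
    · exact absurd (by exact_mod_cast h) hp.ne'
    · exact h
  have t2 : Qᴴ * A * Q = 0 := pA.trace_eq_zero_iff.1 t1
  have t3 : A * Q = 0 := by
    obtain ⟨L, rfl⟩ := psd_factor hA
    have : (L * Q)ᴴ * (L * Q) = 0 := by
      rw [Matrix.conjTranspose_mul, ← t2]; simp only [Matrix.mul_assoc]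
    have := Matrix.conjTranspose_mul_self_eq_zero.1 this
    rw [Matrix.mul_assoc, this, Matrix.mul_zero]
  have t4 : Q * A = 0 := by
    have := congrArg Matrix.conjTranspose t3
    rwa [Matrix.conjTranspose_mul, hQH, hA.1.eq, Matrix.conjTranspose_zero] at this
  refine ⟨S * A, ?_⟩
  rw [← Matrix.mul_assoc]
  calc A = (σ * S + Q) * A := by rw [hPQ, Matrix.one_mul]
    _ = _ := by rw [Matrix.add_mul, t4, add_zero]

lemma relEntropy_vn : relEntropy ρ σ = - vnEntropy ρ - (ρ * matLog σ).trace.re := by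
  simp [relEntropy, vnEntropy, Matrix.mul_sub]

/-- Donald-type identity for two points. -/
lemma donald (τ σ : Matrix n n ℂ) (ε : ℝ) (η : Matrix n n ℂ)
    (hη : η = (ε : ℂ) • τ + ((1 - ε : ℝ) : ℂ) • σ) :
    vnEntropy η - (ε * vnEntropy τ + (1 - ε) * vnEntropy σ) = ε * relEntropy τ σ - relEntropy η σ := by
  rw [relEntropy_vn, relEntropy_vn]
  have : (η * matLog σ).trace.re = ε * (τ * matLog σ).trace.re - (1 - ε) * vnEntropy σ := by
    rw [hη]
    simp [Matrix.add_mul, vnEntropy, -Complex.ofReal_sub]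
  rw [this]; ring

lemma upper {τ : Matrix n n ℂ} (hτ : τ.PosSemidef) (k : σ.PosSemidef) (hX : ∃ X, τ = σ * X)
    (ht : τ.trace = σ.trace) : ∃ C : ℝ, ∀ ε : ℝ, 0 < ε → ε < 1 →
      relEntropy ((ε : ℂ) • τ + ((1 - ε : ℝ) : ℂ) • σ) σ ≤ ε ^ 2 * C ∧
      0 ≤ relEntropy ((ε : ℂ) • τ + ((1 - ε : ℝ) : ℂ) • σ) σ := by
  obtain ⟨X, hX⟩ := hX
  set S := hfun k.1 (fun x => x⁻¹) with hS
  set Δ := τ - σ with hΔ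
  have tΔ : Δ.trace = 0 := by simp [hΔ, ht]
  refine ⟨(Δ * Δ * S).trace.re, fun ε h0 h1 => ?_⟩
  set η := (ε : ℂ) • τ + ((1 - ε : ℝ) : ℂ) • σ with hη
  have hη' : η = σ + (ε : ℂ) • Δ := by
    rw [hη, hΔ]; push_cast; module
  have hΔσ : Δ = σ * (X - 1) := by rw [hΔ, hX, Matrix.mul_sub, Matrix.mul_one]
  have pη : η.PosSemidef := (hτ.smul (by exact_mod_cast h0.le : (0:ℂ) ≤ (ε:ℂ))).add
    (k.smul (by exact_mod_cast (sub_pos.2 h1).le : (0:ℂ) ≤ ((1 - ε : ℝ):ℂ)))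
  have xη : ∃ X, η = σ * X := ⟨1 + (ε : ℂ) • (X - 1), by
    rw [hη', hΔσ, Matrix.mul_add, Matrix.mul_smul, Matrix.mul_one]⟩
  have tη : η.trace = σ.trace := by rw [hη']; simp [tΔ]
  refine ⟨?_, klein_s7 pη k xη tη⟩
  have := chisq pη k xη
  have c0 : S * σ * Δ = Δ := by
    rw [hΔσ, ← Matrix.mul_assoc, pinv]
  have c1 : (σ * σ * S).trace = σ.trace := by
    rw [Matrix.trace_mul_comm, ← Matrix.mul_assoc, pinv]
  have c2 : (σ * Δ * S).trace = 0 := by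
    rw [Matrix.trace_mul_comm, ← Matrix.mul_assoc, c0, tΔ]
  have c3 : (Δ * σ * S).trace = 0 := by
    rw [Matrix.mul_assoc, pinv_comm, Matrix.trace_mul_comm, c0, tΔ]
  have e : (η * η * S).trace = σ.trace + (ε:ℂ) ^ 2 * (Δ * Δ * S).trace := by
    rw [hη']
    simp only [Matrix.add_mul, Matrix.mul_add, Matrix.smul_mul, Matrix.mul_smul, Matrix.trace_add,
      Matrix.trace_smul, c1, c2, c3, smul_eq_mul]
    ring
  rw [← hS, e, tη] at this
  refine this.trans (le_of_eq ?_)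
  rw [Complex.add_re, ← Complex.ofReal_pow, Complex.re_ofReal_mul]
  ring

end

section
variable {dA dB dE : ℕ} (U : Matrix (Fin dB × Fin dE) (Fin dA) ℂ)

/-- A positive trace-preserving linear map. -/
structure PTP {dA : ℕ} {n : Type*} [Fintype n] [DecidableEq n]
    (N : Matrix (Fin dA) (Fin dA) ℂ → Matrix n n ℂ) : Prop where
  add : ∀ a b, N (a + b) = N a + N b
  smul : ∀ (c : ℂ) a, N (c • a) = c • N a
  pos : ∀ a, a.PosSemidef → (N a).PosSemidef
  tr : ∀ a, (N a).trace = a.trace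

lemma ptpB (hU : Uᴴ * U = 1) : PTP (chanB U) where
  add a b := by
    ext i j; simp [chanB, ptraceSnd, Matrix.mul_add, Matrix.add_mul, Finset.sum_add_distrib]
  smul c a := by
    ext i j; simp [chanB, ptraceSnd, Finset.mul_sum]
  pos a ha := by
    have h := ha.mul_mul_conjTranspose_same U
    have : chanB U a = ∑ k, (U * a * Uᴴ).submatrix (fun i => (i, k)) (fun i => (i, k)) := by
      ext i j; simp [chanB, ptraceSnd, Matrix.sum_apply]
    rw [this]
    exact Matrix.posSemidef_sum _ fun k _ => h.submatrix _
  tr a := by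
    have : (chanB U a).trace = (U * a * Uᴴ).trace := by
      simp [chanB, ptraceSnd, Matrix.trace, Fintype.sum_prod_type]
    rw [this, Matrix.trace_mul_comm, ← Matrix.mul_assoc, hU, Matrix.one_mul]

lemma ptpE (hU : Uᴴ * U = 1) : PTP (chanE U) where
  add a b := by
    ext i j; simp [chanE, ptraceFst, Matrix.mul_add, Matrix.add_mul, Finset.sum_add_distrib]
  smul c a := by
    ext i j; simp [chanE, ptraceFst, Finset.mul_sum]
  pos a ha := by
    have h := ha.mul_mul_conjTranspose_same U
    have : chanE U a = ∑ k, (U * a * Uᴴ).submatrix (fun i => (k, i)) (fun i => (k, i)) := by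
      ext i j; simp [chanE, ptraceFst, Matrix.sum_apply]
    rw [this]
    exact Matrix.posSemidef_sum _ fun k _ => h.submatrix _
  tr a := by
    have : (chanE U a).trace = (U * a * Uᴴ).trace := by
      simp [chanE, ptraceFst, Matrix.trace, Fintype.sum_prod_type]
      rw [Finset.sum_comm]
    rw [this, Matrix.trace_mul_comm, ← Matrix.mul_assoc, hU, Matrix.one_mul]

variable {n : Type*} [Fintype n] [DecidableEq n] {N : Matrix (Fin dA) (Fin dA) ℂ → Matrix n n ℂ}

lemma PTP.sum (hN : PTP N) {m : ℕ} (p : Fin m → ℝ) (σ : Fin m → Matrix (Fin dA) (Fin dA) ℂ)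
    (s : Finset (Fin m)) :
    N (∑ u ∈ s, (p u : ℂ) • σ u) = ∑ u ∈ s, (p u : ℂ) • N (σ u) := by
  induction s using Finset.induction_on with
  | empty => simpa using hN.smul 0 0
  | insert a s ha ih => rw [Finset.sum_insert ha, Finset.sum_insert ha, hN.add, hN.smul, ih]

lemma holevo_eq (hN : PTP N) {m : ℕ} (p : Fin m → ℝ) (σ : Fin m → Matrix (Fin dA) (Fin dA) ℂ) :
    holevo N p σ = ∑ u, p u * relEntropy (N (σ u)) (N (∑ u, (p u : ℂ) • σ u)) := by
  unfold holevo
  simp only [relEntropy_vn, mul_sub, Finset.sum_sub_distrib]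
  have : ∀ L : Matrix n n ℂ, (N (∑ u, (p u : ℂ) • σ u) * L).trace.re = ∑ u, p u * (N (σ u) * L).trace.re := by
    intro L
    rw [hN.sum, Finset.sum_mul, Matrix.trace_sum, Complex.re_sum]
    simp
  rw [← this]
  simp [vnEntropy]
  ring

lemma supp_avg (hN : PTP N) {m : ℕ} (p : Fin m → ℝ) (σ : Fin m → Matrix (Fin dA) (Fin dA) ℂ)
    (hp : ∀ u, 0 ≤ p u) (hσ : ∀ u, (σ u).PosSemidef) (u : Fin m) (hu : 0 < p u) :
    suppLE (N (σ u)) (N (∑ u, (p u : ℂ) • σ u)) := by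
  refine exists_supp (supp_of_add (C := ∑ v ∈ Finset.univ.erase u, (p v : ℂ) • N (σ v))
    (hN.pos _ (hσ u)) (Matrix.posSemidef_sum _ fun v _ =>
      (hN.pos _ (hσ v)).smul (by exact_mod_cast hp v : (0:ℂ) ≤ (p v : ℂ))) (p u) hu ?_)
  rw [hN.sum]
  exact (Finset.add_sum_erase _ (fun v => (p v : ℂ) • N (σ v)) (Finset.mem_univ u)).symm

lemma holevo_two (hN : PTP N) (ρ ρh : Matrix (Fin dA) (Fin dA) ℂ) (ε : ℝ) :
    holevo N ![ε, 1 - ε] ![ρ, ρh] = ε * relEntropy (N ρ) (N ρh) -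
      relEntropy ((ε : ℂ) • N ρ + ((1 - ε : ℝ) : ℂ) • N ρh) (N ρh) := by
  rw [← donald (N ρ) (N ρh) ε _ rfl]
  unfold holevo
  rw [hN.sum]
  simp only [Fin.sum_univ_two, Matrix.cons_val_zero, Matrix.cons_val_one]

end

/-- The channel is less noisy at `n = 1` (every finite ensemble of states
has Holevo quantity w.r.t. `N_B` at least that w.r.t. `N_E`) if and only if it is less
divergence contracting at `n = 1`. -/
theorem less_noisy_iff_less_divergence_contracting
    {dA dB dE : ℕ} (hdA : 1 ≤ dA) (hdB : 1 ≤ dB) (hdE : 1 ≤ dE)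
    (U : Matrix (Fin dB × Fin dE) (Fin dA) ℂ) (hU : Uᴴ * U = 1) :
    (∀ (m : ℕ) (p : Fin m → ℝ) (σ : Fin m → Matrix (Fin dA) (Fin dA) ℂ),
      IsEnsemble p σ → holevo (chanE U) p σ ≤ holevo (chanB U) p σ)
    ↔ (∀ ρ ρhat : Matrix (Fin dA) (Fin dA) ℂ, IsState ρ → IsState ρhat →
      suppLE (chanB U ρ) (chanB U ρhat) → suppLE (chanE U ρ) (chanE U ρhat) →
      relEntropy (chanE U ρ) (chanE U ρhat) ≤ relEntropy (chanB U ρ) (chanB U ρhat)) := by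
  have hB := ptpB U hU
  have hE := ptpE U hU
  constructor
  · intro H ρ ρh hρ hρh sB sE
    obtain ⟨CB, hCB⟩ := upper (hB.pos _ hρ.1) (hB.pos _ hρh.1) (supp_exists sB)
      (by rw [hB.tr, hB.tr, hρ.2, hρh.2])
    obtain ⟨CE, hCE⟩ := upper (hE.pos _ hρ.1) (hE.pos _ hρh.1) (supp_exists sE)
      (by rw [hE.tr, hE.tr, hρ.2, hρh.2])
    have key : ∀ ε : ℝ, 0 < ε → ε < 1 → relEntropy (chanE U ρ) (chanE U ρh) ≤
        relEntropy (chanB U ρ) (chanB U ρh) + ε * CE := by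
      intro ε h0 h1
      have h := H 2 ![ε, 1 - ε] ![ρ, ρh] ⟨?_, ?_, ?_⟩
      · rw [holevo_two hB, holevo_two hE] at h
        have a := (hCB ε h0 h1).2
        have b := (hCE ε h0 h1).1
        have : ε * relEntropy (chanE U ρ) (chanE U ρh) ≤
          ε * (relEntropy (chanB U ρ) (chanB U ρh) + ε * CE) := by nlinarith
        exact le_of_mul_le_mul_left this h0
      · intro u; fin_cases u <;> simp <;> linarith
      · simp
      · intro u; fin_cases u <;> simpa
    refine le_of_forall_pos_le_add fun δ hδ => ?_
    have hpos : 0 < |CE| + 1 := by positivity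
    set ε := min (1/2) (δ / (|CE| + 1)) with hε
    have h0 : 0 < ε := lt_min (by norm_num) (div_pos hδ hpos)
    have h1 : ε < 1 := (min_le_left _ _).trans_lt (by norm_num)
    have h2 : ε * (|CE| + 1) ≤ δ := (le_div_iff₀ hpos).1 (min_le_right _ _)
    have h3 := key ε h0 h1
    have h4 : ε * CE ≤ ε * (|CE| + 1) :=
      mul_le_mul_of_nonneg_left (by linarith [le_abs_self CE]) h0.le
    linarith
  · intro H m p σ hens
    obtain ⟨hp, hs, hσ⟩ := hens
    rw [holevo_eq hB, holevo_eq hE]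
    refine Finset.sum_le_sum fun u _ => ?_
    rcases (hp u).eq_or_lt with h | h
    · rw [← h]; simp
    refine mul_le_mul_of_nonneg_left ?_ h.le
    have pp : ∀ v, (σ v).PosSemidef := fun v => (hσ v).1
    refine H _ _ (hσ u) ⟨?_, ?_⟩ (supp_avg hB p σ hp pp u h) (supp_avg hE p σ hp pp u h)
    · exact Matrix.posSemidef_sum _ fun v _ => (pp v).smul (by exact_mod_cast hp v : (0:ℂ) ≤ (p v : ℂ))
    · rw [Matrix.trace_sum]
      simp only [Matrix.trace_smul, (hσ _).2, smul_eq_mul, mul_one]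
      exact_mod_cast hs

end
end
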